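/- Let C and D be model categories. For every n ≥ 0, the inclusion Fun([n], D^f)^{W^f} ↪ Fun([n], D)^{W} induces a weak homotopy equivalence of nerves N(Fun([n], D^f)^{W^f}) → N(Fun([n], D)^{W}); dually, for every n ≥ 0 the inclusion Fun([n], C^c)^{W^c} ↪ Fun([n], C)^{W} induces a weak homotopy equivalence of nerves. (Equivalently: the inclusions (C^c, W^c) ↪ (C, W) and (D^f, W^f) ↪ (D, W) induce levelwise weak equivalences of Rezk nerves, i.e., are weak equivalences in the Barwick–Kan model structure on relative categories.) -/

import Mathlib

open CategoryTheory CategoryTheory.Limits Simplicial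

universe w v u

namespace Paper

/-- The map constant at vertex `i` of `Δ[1]`. -/
def constVertex (X : SSet.{w}) (i : Fin 2) : X ⟶ Δ[1] where
  app m := ↾fun _ => ULift.up (SimplexCategory.const m.unop ⦋1⦌ i)
  naturality _ _ _ := by ext _; rfl

/-- Elementary simplicial homotopy between two maps of simplicial sets,
given by a map out of the cylinder `X ⨯ Δ[1]`. -/
def SHomotopy {X Y : SSet.{w}} (f g : X ⟶ Y) : Prop :=
  ∃ H : X ⨯ Δ[1] ⟶ Y,
    prod.lift (𝟙 X) (constVertex X 0) ≫ H = f ∧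
    prod.lift (𝟙 X) (constVertex X 1) ≫ H = g

/-- The relation of being simplicially homotopic: the equivalence relation
generated by elementary simplicial homotopies. -/
def Htpy {X Y : SSet.{w}} (f g : X ⟶ Y) : Prop := Relation.EqvGen SHomotopy f g

/-- A map of simplicial sets is a weak homotopy equivalence (in the Kan–Quillen sense)
iff for every Kan complex `K` the induced map on simplicial homotopy classes of maps
into `K` is a bijection. -/
def IsWeakHomotopyEquiv {X Y : SSet.{w}} (f : X ⟶ Y) : Prop :=
  ∀ (K : SSet.{w}), SSet.KanComplex K →
    (∀ g : X ⟶ K, ∃ h : Y ⟶ K, Htpy (f ≫ h) g) ∧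
    (∀ h h' : Y ⟶ K, Htpy (f ≫ h) (f ≫ h') → Htpy h h')

/-- A simplicial set is weakly contractible if its map to the terminal object
is a weak homotopy equivalence. -/
def WeaklyContractible (X : SSet.{w}) : Prop := IsWeakHomotopyEquiv (terminal.from X)

/-- The map on nerves induced by a functor. -/
def nerveMap {C : Type u} {D : Type u} [Category.{v} C] [Category.{v} D] (F : C ⥤ D) :
    nerve C ⟶ nerve D where
  app _ := ↾fun G => G ⋙ F
  naturality _ _ _ := rfl



/-- `f` is a retract of `g` in the arrow category. -/
def IsRetractOf {C : Type u} [Category.{v} C] {X Y X' Y' : C} (f : X ⟶ Y) (g : X' ⟶ Y') : Prop :=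
  ∃ (i : X ⟶ X') (r : X' ⟶ X) (j : Y ⟶ Y') (s : Y' ⟶ Y),
    i ≫ r = 𝟙 X ∧ j ≫ s = 𝟙 Y ∧ i ≫ g = f ≫ j ∧ r ≫ f = g ≫ s

/-- A (Quillen) model structure on a category: three wide subcategories of weak
equivalences, cofibrations and fibrations, satisfying the two-out-of-three, retract,
lifting and factorization axioms.  (No functorial factorizations are assumed; a model
category is a finitely bicomplete category equipped with such a structure.) -/
structure ModelStructure (C : Type u) [Category.{v} C] where
  W : MorphismProperty C
  Cof : MorphismProperty C
  Fib : MorphismProperty C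
  W_id : ∀ X : C, W (𝟙 X)
  Cof_id : ∀ X : C, Cof (𝟙 X)
  Fib_id : ∀ X : C, Fib (𝟙 X)
  W_comp : ∀ {X Y Z : C} (f : X ⟶ Y) (g : Y ⟶ Z), W f → W g → W (f ≫ g)
  Cof_comp : ∀ {X Y Z : C} (f : X ⟶ Y) (g : Y ⟶ Z), Cof f → Cof g → Cof (f ≫ g)
  Fib_comp : ∀ {X Y Z : C} (f : X ⟶ Y) (g : Y ⟶ Z), Fib f → Fib g → Fib (f ≫ g)
  W_of_precomp : ∀ {X Y Z : C} (f : X ⟶ Y) (g : Y ⟶ Z), W f → W (f ≫ g) → W g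
  W_of_postcomp : ∀ {X Y Z : C} (f : X ⟶ Y) (g : Y ⟶ Z), W g → W (f ≫ g) → W f
  W_retract : ∀ {X Y X' Y' : C} {f : X ⟶ Y} {g : X' ⟶ Y'}, IsRetractOf f g → W g → W f
  Cof_retract : ∀ {X Y X' Y' : C} {f : X ⟶ Y} {g : X' ⟶ Y'}, IsRetractOf f g → Cof g → Cof f
  Fib_retract : ∀ {X Y X' Y' : C} {f : X ⟶ Y} {g : X' ⟶ Y'}, IsRetractOf f g → Fib g → Fib f
  lifting_acof_fib : ∀ {A B X Y : C} (i : A ⟶ B) (p : X ⟶ Y),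
    Cof i → W i → Fib p → HasLiftingProperty i p
  lifting_cof_afib : ∀ {A B X Y : C} (i : A ⟶ B) (p : X ⟶ Y),
    Cof i → Fib p → W p → HasLiftingProperty i p
  fact_acof_fib : ∀ {X Y : C} (f : X ⟶ Y),
    ∃ (Z : C) (i : X ⟶ Z) (p : Z ⟶ Y), Cof i ∧ W i ∧ Fib p ∧ i ≫ p = f
  fact_cof_afib : ∀ {X Y : C} (f : X ⟶ Y),
    ∃ (Z : C) (i : X ⟶ Z) (p : Z ⟶ Y), Cof i ∧ Fib p ∧ W p ∧ i ≫ p = f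

/-- An object is cofibrant if the map from an initial object is a cofibration. -/
def Cofibrant {C : Type u} [Category.{v} C] [HasInitial C] (M : ModelStructure C) (X : C) :
    Prop := M.Cof (initial.to X)

/-- An object is fibrant if the map to a terminal object is a fibration. -/
def Fibrant {C : Type u} [Category.{v} C] [HasTerminal C] (M : ModelStructure C) (X : C) :
    Prop := M.Fib (terminal.from X)

/-- A category with a wide subcategory of weak equivalences (a relative category
whose weak equivalences form a wide subcategory). -/
structure RelCatStruct (R : Type u) [Category.{v} R] where
  W : MorphismProperty R
  W_id : ∀ X : R, W (𝟙 X)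
  W_comp : ∀ {X Y Z : R} (f : X ⟶ Y) (g : Y ⟶ Z), W f → W g → W (f ≫ g)

/-- The underlying relative category of a model structure. -/
def ModelStructure.relcat {C : Type u} [Category.{v} C] (M : ModelStructure C) :
    RelCatStruct C :=
  ⟨M.W, M.W_id, M.W_comp⟩

/-- A Quillen adjunction between model categories: an adjunction `F ⊣ G` such that
`F` preserves cofibrations and acyclic cofibrations. -/
structure QuillenAdjunction {C : Type u} {D : Type u} [Category.{v} C] [Category.{v} D]
    (MC : ModelStructure C) (MD : ModelStructure D) where
  F : C ⥤ D
  G : D ⥤ C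
  adj : F ⊣ G
  F_cof : ∀ {X Y : C} (f : X ⟶ Y), MC.Cof f → MD.Cof (F.map f)
  F_acof : ∀ {X Y : C} (f : X ⟶ Y), MC.Cof f → MC.W f → MD.W (F.map f)


/-- The wide subcategory `Fun([n],R)^{W}` of the functor category `Fun([n],R)`:
objects are all functors `[n] ⥤ R`, morphisms are the natural transformations all of
whose components are weak equivalences. -/
structure FunW (n : ℕ) (R : Type u) [Category.{v} R] (ρ : RelCatStruct R) where
  F : Fin (n + 1) ⥤ R

/-- Morphisms of `FunW`: natural transformations with all components in `W`. -/
instance {n : ℕ} {R : Type u} [Category.{v} R] {ρ : RelCatStruct R} :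
    Category (FunW n R ρ) where
  Hom A B := { η : A.F ⟶ B.F // ∀ k, ρ.W (η.app k) }
  id A := ⟨𝟙 A.F, fun k => ρ.W_id _⟩
  comp η θ := ⟨η.1 ≫ θ.1, fun k => ρ.W_comp _ _ (η.2 k) (θ.2 k)⟩
  id_comp _ := by apply Subtype.ext; simp
  comp_id _ := by apply Subtype.ext; simp
  assoc _ _ _ := by apply Subtype.ext; simp

section ChainPairing

open scoped Classical in
/-- The set of vertices of a simplex of the nerve of a preorder. -/
noncomputable def vertices {P : Type w} [Preorder P] {n : ℕ} (x : (nerve P) _⦋n⦌) : Finset P :=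
  Finset.univ.image x.obj

variable {P : Type w} [PartialOrder P]

lemma mem_vertices {n : ℕ} {x : (nerve P) _⦋n⦌} {p : P} :
    p ∈ vertices x ↔ ∃ i, x.obj i = p := by
  simp [vertices]

lemma vertices_le_iff {x y : (nerve P).N} :
    x ≤ y ↔ vertices x.simplex ⊆ vertices y.simplex := by
  constructor
  · intro h p hp
    obtain ⟨f, -, hf⟩ := SSet.N.le_iff_exists_mono.1 h
    obtain ⟨i, rfl⟩ := mem_vertices.1 hp
    rw [← hf]
    exact mem_vertices.2 ⟨f.toOrderHom i, rfl⟩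
  · intro h
    have hy := (PartialOrder.mem_nerve_nonDegenerate_iff_strictMono _).1 y.nonDegenerate
    have hx := (PartialOrder.mem_nerve_nonDegenerate_iff_strictMono _).1 x.nonDegenerate
    have key : ∀ i, ∃ j, y.simplex.obj j = x.simplex.obj i := fun i =>
      mem_vertices.1 (h (mem_vertices.2 ⟨i, rfl⟩))
    choose f hf using key
    have hmono : Monotone f := fun i j hij => by
      rw [← hy.le_iff_le, hf, hf]
      exact x.simplex.monotone hij
    rw [SSet.N.le_iff, Subfunctor.ofSection_le_iff, SSet.Subcomplex.mem_ofSimplex_obj_iff]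
    refine ⟨SimplexCategory.mkHom ⟨f, hmono⟩, ?_⟩
    exact CategoryTheory.Functor.ext (fun i => hf i) (fun _ _ _ => Subsingleton.elim _ _)

lemma vertices_injective {x y : (nerve P).N}
    (h : vertices x.simplex = vertices y.simplex) : x = y :=
  le_antisymm (vertices_le_iff.2 h.le) (vertices_le_iff.2 h.ge)

lemma card_vertices (x : (nerve P).N) : (vertices x.simplex).card = x.dim + 1 := by
  classical
  rw [vertices, Finset.card_image_of_injective, Finset.card_univ]
  · simp
  · exact (PartialOrder.mem_nerve_nonDegenerate_iff_injective _).1 x.nonDegenerate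

lemma isChain_vertices {n : ℕ} (x : (nerve P) _⦋n⦌) :
    IsChain (· ≤ ·) (vertices x : Set P) := by
  intro a ha b hb _
  obtain ⟨i, rfl⟩ := mem_vertices.1 ha
  obtain ⟨j, rfl⟩ := mem_vertices.1 hb
  exact (le_total i j).imp (fun h => x.monotone h) (fun h => x.monotone h)

lemma exists_vertices_eq (c : Finset P) (hc : IsChain (· ≤ ·) (c : Set P)) (hne : c.Nonempty) :
    ∃ x : (nerve P).N, vertices x.simplex = c := by
  classical
  let : LinearOrder c :=
    { (inferInstance : PartialOrder c) with
      le_total := fun a b => hc.total a.2 b.2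
      toDecidableLE := Classical.decRel _ }
  obtain ⟨n, hn⟩ : ∃ n, c.card = n + 1 := ⟨c.card - 1, by have := hne.card_pos; lia⟩
  let e : Fin (n + 1) ≃o c := Fintype.orderIsoFinOfCardEq c (by simpa using hn)
  let g : Fin (n + 1) →o P := ⟨fun i => (e i).1, fun i j h => e.monotone h⟩
  let x : (nerve P) _⦋n⦌ := g.monotone.functor
  refine ⟨SSet.N.mk x ?_, ?_⟩
  · rw [PartialOrder.mem_nerve_nonDegenerate_iff_injective]
    exact Subtype.val_injective.comp e.injective
  · ext p
    refine mem_vertices.trans ⟨?_, fun hp => ?_⟩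
    · rintro ⟨i, rfl⟩
      exact (e i).2
    · exact ⟨e.symm ⟨p, hp⟩, congrArg Subtype.val (e.apply_symm_apply ⟨p, hp⟩)⟩

open scoped Classical in
/-- A subcomplex `A` of the nerve of a partial order is anodyne as soon as the chains which do not
belong to `A` can be paired by inserting or erasing a vertex `z c`, in a well-founded way. -/
theorem anodyneExtensions_of_toggle (A : (nerve P).Subcomplex) (T : Finset P → Prop)
    (hA : ∀ n (x : (nerve P) _⦋n⦌), x ∉ A.obj _ ↔ T (vertices x))
    (hT : ∀ c, T c → IsChain (· ≤ ·) (c : Set P) ∧ c.Nonempty) (z : Finset P → P)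
    (T_insert : ∀ c, T c → T (insert (z c) c))
    (T_erase : ∀ c, T c → z c ∈ c → T (c.erase (z c)))
    (z_insert : ∀ c, T c → z (insert (z c) c) = z c)
    (z_erase : ∀ c, T c → z c ∈ c → z (c.erase (z c)) = z c)
    {α : Type*} [PartialOrder α] [WellFoundedLT α] (rank : Finset P → α)
    (hrank : ∀ c, T c → z c ∉ c → ∀ w ∈ c, T ((insert (z c) c).erase w) →
      z ((insert (z c) c).erase w) ∉ (insert (z c) c).erase w →
      rank ((insert (z c) c).erase w) < rank c) :
    SSet.anodyneExtensions A.ι := by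
  let v : A.N → {c // T c} := fun x => ⟨vertices x.simplex, (hA _ _).1 x.notMem⟩
  have hv : Function.Bijective v := by
    refine ⟨fun x y h => ?_, fun c => ?_⟩
    · rw [SSet.Subcomplex.N.ext_iff]
      exact vertices_injective (congrArg Subtype.val h)
    · obtain ⟨x, hx⟩ := exists_vertices_eq c.1 (hT _ c.2).1 (hT _ c.2).2
      exact ⟨SSet.Subcomplex.N.mk' x ((hA _ _).2 (by rw [hx]; exact c.2)), Subtype.ext hx⟩
  let e := Equiv.ofBijective v hv
  have he : ∀ x, (e x).1 = vertices x.simplex := fun _ => rfl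
  have hcard : ∀ x : A.N, (e x).1.card = x.dim + 1 := fun x => card_vertices x.toN
  have hle : ∀ {x y : A.N}, x ≤ y ↔ (e x).1 ⊆ (e y).1 := vertices_le_iff
  let Q : A.Pairing :=
    { I := {x | z (e x).1 ∈ (e x).1}
      II := {x | z (e x).1 ∉ (e x).1}
      inter := by ext x; simp
      union := by ext x; simpa using em _
      p :=
        { toFun x := ⟨e.symm ⟨_, T_insert _ (e x.1).2⟩, by simp [z_insert _ (e x.1).2]⟩
          invFun y := ⟨e.symm ⟨_, T_erase _ (e y.1).2 y.2⟩, by simp [z_erase _ (e y.1).2 y.2]⟩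
          left_inv x := by
            apply Subtype.ext
            apply e.injective
            apply Subtype.ext
            have : z (e x.1).1 ∉ (e x.1).1 := x.2
            simp [z_insert _ (e x.1).2, this]
          right_inv y := by
            apply Subtype.ext
            apply e.injective
            apply Subtype.ext
            have : z (e y.1).1 ∈ (e y.1).1 := y.2
            simp [z_erase _ (e y.1).2 y.2, this] } }
  have hp : ∀ x : Q.II, (e (Q.p x).1).1 = insert (z (e x.1).1) (e x.1).1 := fun x => by
    change (e (e.symm _)).1 = _
    rw [Equiv.apply_symm_apply]
  have : Q.IsProper := ⟨fun x => by
    have hx : z (e x.1).1 ∉ (e x.1).1 := x.2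
    refine ⟨?_, SSet.N.existsUnique_of_le (X := nerve P) (x := x.1.toN) (y := (Q.p x).1.toN) ?_⟩
    · have := hcard (Q.p x).1
      rw [hp, Finset.card_insert_of_notMem hx, hcard] at this
      lia
    · have : x.1 ≤ (Q.p x).1 := by
        rw [hle, hp]
        exact Finset.subset_insert _ _
      exact this⟩
  have rk : Q.WeakRankFunction α :=
    { rank := fun x => rank (e x.1).1
      lt := by
        intro x y hxy hdim
        have hy : z (e y.1).1 ∉ (e y.1).1 := y.2
        have hx : z (e x.1).1 ∉ (e x.1).1 := x.2
        have hsub := hle.1 hxy.2.le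
        rw [hp] at hsub
        have hcx : (e x.1).1.card = (e y.1).1.card := by rw [hcard, hcard, hdim]
        obtain ⟨w, hw, hw'⟩ : ∃ w ∈ insert (z (e y.1).1) (e y.1).1, w ∉ (e x.1).1 := by
          by_contra! h
          have := Finset.card_le_card h
          rw [Finset.card_insert_of_notMem hy] at this
          lia
        have hxe : (e x.1).1 = (insert (z (e y.1).1) (e y.1).1).erase w := by
          apply Finset.eq_of_subset_of_card_le
          · exact Finset.subset_erase.2 ⟨hsub, hw'⟩
          · rw [Finset.card_erase_of_mem hw, Finset.card_insert_of_notMem hy]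
            lia
        have hwz : w ≠ z (e y.1).1 := by
          rintro rfl
          rw [Finset.erase_insert hy] at hxe
          exact hxy.1 (Subtype.ext (e.injective (Subtype.ext hxe)))
        have := hrank _ (e y.1).2 hy w (Finset.mem_of_mem_insert_of_ne hw hwz)
        rw [← hxe] at this
        exact this (e x.1).2 hx }
  have := rk.isRegular
  exact Q.anodyneExtensions

end ChainPairing

section TaggedWords

/-- A nonempty finite set of natural numbers together with a monotone map to `[m]`,
encoded by its graph. -/
@[ext]
structure TaggedWord (m : SimplexCategory) : Type w where
  graph : Finset (ℕ × Fin (m.len + 1))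
  nonempty : graph.Nonempty
  mono : ∀ p ∈ graph, ∀ q ∈ graph, p.1 ≤ q.1 → p.2 ≤ q.2

instance (m : SimplexCategory) : PartialOrder (TaggedWord.{w} m) :=
  PartialOrder.lift TaggedWord.graph fun _ _ h => TaggedWord.ext h

/-- The poset obtained from `TaggedWord m` by attaching `[m]` on top: a word is below `i`
if all its tags are at most `i`. -/
inductive CappedWord (m : SimplexCategory) : Type w where
  | word (G : TaggedWord.{w} m)
  | vertex (i : Fin (m.len + 1))

namespace CappedWord

variable {m m' : SimplexCategory}

instance : LE (CappedWord.{w} m) where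
  le
    | word G, word G' => G ≤ G'
    | word G, vertex i => ∀ p ∈ G.graph, p.2 ≤ i
    | vertex _, word _ => False
    | vertex i, vertex j => i ≤ j

instance : PartialOrder (CappedWord.{w} m) where
  le_refl
    | word G => le_refl G
    | vertex i => le_refl i
  le_trans
    | word _, word _, word _, h, h' => le_trans (α := TaggedWord m) h h'
    | word _, word _, vertex _, h, h' => fun p hp => h' p (h hp)
    | word _, vertex _, vertex _, h, h' => fun p hp => (h p hp).trans h'
    | vertex _, vertex _, vertex _, h, h' => le_trans (α := Fin _) h h'
    | word _, vertex _, word _, _, h' => h'.elim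
    | vertex _, word _, _, h, _ => h.elim
    | vertex _, vertex _, word _, _, h' => h'.elim
  le_antisymm
    | word _, word _, h, h' => congrArg word (le_antisymm h h')
    | word _, vertex _, _, h' => h'.elim
    | vertex _, word _, h, _ => h.elim
    | vertex _, vertex _, h₁, h₂ => congrArg vertex (le_antisymm h₁ h₂)

/-- The graph of a word; empty for a vertex. -/
def graph (q : CappedWord.{w} m) : Finset (ℕ × Fin (m.len + 1)) :=
  q.casesOn (fun G => G.graph) (fun _ => ∅)

/-- The tags occurring in a capped word. -/
def tags (q : CappedWord.{w} m) : Finset (Fin (m.len + 1)) :=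
  q.casesOn (fun G => G.graph.image Prod.snd) (fun i => {i})

/-- The subcomplex of the nerve of `CappedWord m` of simplices which either consist of words or do
not involve all the tags. -/
def boundary (m : SimplexCategory) : (nerve (CappedWord.{w} m)).Subcomplex where
  obj _ := {f | (∀ k, ∃ G, f.obj k = word G) ∨ ∃ i, ∀ k, i ∉ tags (f.obj k)}
  map θ _ hf := hf.imp (fun h k => h (θ.unop.toOrderHom k))
    (fun ⟨i, h⟩ => ⟨i, fun k => h (θ.unop.toOrderHom k)⟩)

/-- The chains of capped words which do not belong to the boundary. -/
structure IsFull (c : Finset (CappedWord.{w} m)) : Prop where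
  chain : IsChain (· ≤ ·) (c : Set (CappedWord.{w} m))
  exists_vertex : ∃ i, vertex i ∈ c
  tags : ∀ i, ∃ q ∈ c, i ∈ tags q

lemma notMem_boundary_iff {n : ℕ} (x : (nerve (CappedWord.{w} m)) _⦋n⦌) :
    x ∉ (boundary m).obj _ ↔ IsFull (vertices x) := by
  change ¬ (_ ∨ _) ↔ _
  push Not
  constructor
  · rintro ⟨⟨k, hk⟩, h⟩
    refine ⟨isChain_vertices x, ?_, fun i => ?_⟩
    · cases hi : x.obj k with
      | word G => exact (hk G hi).elim
      | vertex i => exact ⟨i, mem_vertices.2 ⟨k, hi⟩⟩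
    · obtain ⟨k, hk⟩ := h i
      exact ⟨_, mem_vertices.2 ⟨k, rfl⟩, hk⟩
  · intro h
    constructor
    · obtain ⟨i, hi⟩ := h.exists_vertex
      obtain ⟨k, hk⟩ := mem_vertices.1 hi
      exact ⟨k, by simp [hk]⟩
    · intro i
      obtain ⟨q, hq, hi⟩ := h.tags i
      obtain ⟨k, rfl⟩ := mem_vertices.1 hq
      exact ⟨k, hi⟩

open scoped Classical in
/-- The vertices in a set of capped words. -/
noncomputable def verts (c : Finset (CappedWord.{w} m)) : Finset (Fin (m.len + 1)) :=
  {i | vertex i ∈ c}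

lemma mem_verts {c : Finset (CappedWord.{w} m)} {i : Fin (m.len + 1)} :
    i ∈ verts c ↔ vertex i ∈ c := by simp [verts]

open scoped Classical in
/-- The least vertex. -/
noncomputable def bot (c : Finset (CappedWord.{w} m)) : Fin (m.len + 1) :=
  if h : (verts c).Nonempty then (verts c).min' h else 0

/-- The first letter larger than all the letters whose tag is smaller than the least vertex. -/
noncomputable def letter (c : Finset (CappedWord.{w} m)) : ℕ :=
  c.sup fun q => (q.graph.filter fun p => p.2 < bot c).sup fun p => p.1 + 1

open scoped Classical in
/-- The union of the words not containing the distinguished tagged letter. -/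
noncomputable def low (c : Finset (CappedWord.{w} m)) : Finset (ℕ × Fin (m.len + 1)) :=
  (c.filter fun q => (letter c, bot c) ∉ q.graph).biUnion graph

open scoped Classical in
/-- The word used to pair chains of capped words. -/
noncomputable def pivot (c : Finset (CappedWord.{w} m)) : CappedWord.{w} m :=
  if h : ∀ p ∈ insert (letter c, bot c) (low c), ∀ q ∈ insert (letter c, bot c) (low c),
    p.1 ≤ q.1 → p.2 ≤ q.2 then word ⟨_, Finset.insert_nonempty _ _, h⟩ else vertex 0

lemma mem_low {c : Finset (CappedWord.{w} m)} {p : ℕ × Fin (m.len + 1)} :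
    p ∈ low c ↔ ∃ q ∈ c, (letter c, bot c) ∉ q.graph ∧ p ∈ q.graph := by
  simp [low, and_assoc]

lemma letter_le_iff {c : Finset (CappedWord.{w} m)} {l : ℕ} :
    letter c ≤ l ↔ ∀ q ∈ c, ∀ p ∈ q.graph, p.2 < bot c → p.1 + 1 ≤ l := by
  simp [letter, Finset.sup_le_iff]

lemma lt_letter {c : Finset (CappedWord.{w} m)} {q : CappedWord.{w} m} (hq : q ∈ c)
    {p : ℕ × Fin (m.len + 1)} (hp : p ∈ q.graph) (h : p.2 < bot c) : p.1 < letter c :=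
  letter_le_iff.1 le_rfl q hq p hp h

lemma bot_congr {c c' : Finset (CappedWord.{w} m)} (h : verts c = verts c') : bot c = bot c' := by
  simp only [bot, h]

lemma pivot_congr {c c' : Finset (CappedWord.{w} m)} (hb : bot c = bot c')
    (hl : letter c = letter c') (h : low c = low c') : pivot c = pivot c' := by
  simp only [pivot, hb, hl, h]

variable {c : Finset (CappedWord.{w} m)}

lemma IsFull.bot_mem (hc : IsFull c) : vertex (bot c) ∈ c := by
  obtain ⟨i, hi⟩ := hc.exists_vertex
  have h : (verts c).Nonempty := ⟨i, mem_verts.2 hi⟩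
  rw [bot, dif_pos h, ← mem_verts]
  exact Finset.min'_mem _ _

lemma bot_le {i : Fin (m.len + 1)} (hi : vertex i ∈ c) : bot c ≤ i := by
  have h : (verts c).Nonempty := ⟨i, mem_verts.2 hi⟩
  rw [bot, dif_pos h]
  exact Finset.min'_le _ _ (mem_verts.2 hi)

lemma IsFull.snd_le_bot (hc : IsFull c) {q : CappedWord.{w} m} (hq : q ∈ c)
    {p : ℕ × Fin (m.len + 1)} (hp : p ∈ q.graph) : p.2 ≤ bot c := by
  cases q with
  | word G => exact ((hc.chain.total hq hc.bot_mem).resolve_right id) p hp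
  | vertex i => simp [graph] at hp

lemma IsFull.total (hc : IsFull c) {q q' : CappedWord.{w} m} (hq : q ∈ c) (hq' : q' ∈ c) :
    q.graph ⊆ q'.graph ∨ q'.graph ⊆ q.graph := by
  cases q with
  | vertex i => exact Or.inl (by simp [graph])
  | word G =>
    cases q' with
    | vertex i => exact Or.inr (by simp [graph])
    | word G' => exact hc.chain.total hq hq'

lemma IsFull.pivot_eq (hc : IsFull c) :
    ∃ G : TaggedWord.{w} m, pivot c = word G ∧
      ∀ p, p ∈ G.graph ↔ p = (letter c, bot c) ∨ p ∈ low c := by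
  have h : ∀ p ∈ insert (letter c, bot c) (low c), ∀ q ∈ insert (letter c, bot c) (low c),
      p.1 ≤ q.1 → p.2 ≤ q.2 := by
    intro p hp p' hp' hle
    rw [Finset.mem_insert, mem_low] at hp hp'
    obtain rfl | ⟨q, hq, hq', hp⟩ := hp <;> obtain rfl | ⟨q₁, hq₁, hq₁', hp'⟩ := hp'
    · exact le_rfl
    · by_contra! hlt
      exact (lt_letter hq₁ hp' hlt).not_ge hle
    · exact hc.snd_le_bot hq hp
    · obtain ⟨q, p, p'⟩ : ∃ q : CappedWord.{w} m, p ∈ q.graph ∧ p' ∈ q.graph := by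
        obtain h | h := hc.total hq hq₁
        · exact ⟨_, h hp, hp'⟩
        · exact ⟨_, hp, h hp'⟩
      cases q with
      | word G => exact G.mono _ p _ p' hle
      | vertex i => simp [graph] at p
  exact ⟨_, dif_pos h, fun p => Finset.mem_insert⟩

lemma IsFull.mem_graph_pivot (hc : IsFull c) {p : ℕ × Fin (m.len + 1)} :
    p ∈ (pivot c).graph ↔ p = (letter c, bot c) ∨ p ∈ low c := by
  obtain ⟨G, hG, h⟩ := hc.pivot_eq
  rw [hG]
  exact h p

lemma verts_insert_word [DecidableEq (CappedWord.{w} m)] (G : TaggedWord.{w} m) :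
    verts (insert (word G) c) = verts c := by
  ext i; simp [mem_verts]

lemma verts_erase_word [DecidableEq (CappedWord.{w} m)] (G : TaggedWord.{w} m) :
    verts (c.erase (word G)) = verts c := by
  ext i; simp [mem_verts]

lemma IsFull.ne_pivot (hc : IsFull c) {q : CappedWord.{w} m}
    (hq : (letter c, bot c) ∉ q.graph) : q ≠ pivot c := by
  rintro rfl
  exact hq (hc.mem_graph_pivot.2 (Or.inl rfl))

variable [DecidableEq (CappedWord.{w} m)]

lemma IsFull.verts_insert (hc : IsFull c) : verts (insert (pivot c) c) = verts c := by
  obtain ⟨G, hG, -⟩ := hc.pivot_eq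
  rw [hG, verts_insert_word]

lemma IsFull.letter_insert (hc : IsFull c) : letter (insert (pivot c) c) = letter c := by
  have hb := bot_congr hc.verts_insert
  apply le_antisymm
  · rw [letter_le_iff, hb]
    intro q hq p hp hlt
    obtain rfl | hq := Finset.mem_insert.1 hq
    · obtain rfl | hp := hc.mem_graph_pivot.1 hp
      · exact (lt_irrefl _ hlt).elim
      · obtain ⟨q, hq, -, hp⟩ := mem_low.1 hp
        exact lt_letter hq hp hlt
    · exact lt_letter hq hp hlt
  · rw [letter_le_iff]
    intro q hq p hp hlt
    exact lt_letter (Finset.mem_insert_of_mem hq) hp (hb ▸ hlt)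

lemma IsFull.low_insert (hc : IsFull c) : low (insert (pivot c) c) = low c := by
  ext p
  rw [mem_low, mem_low, hc.letter_insert, bot_congr hc.verts_insert]
  have : (letter c, bot c) ∈ (pivot c).graph := hc.mem_graph_pivot.2 (Or.inl rfl)
  simp [this]

lemma IsFull.pivot_insert (hc : IsFull c) : pivot (insert (pivot c) c) = pivot c :=
  pivot_congr (bot_congr hc.verts_insert) hc.letter_insert hc.low_insert

lemma IsFull.verts_erase (hc : IsFull c) : verts (c.erase (pivot c)) = verts c := by
  obtain ⟨G, hG, -⟩ := hc.pivot_eq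
  rw [hG, verts_erase_word]

lemma IsFull.letter_erase (hc : IsFull c) : letter (c.erase (pivot c)) = letter c := by
  have hb := bot_congr hc.verts_erase
  apply le_antisymm
  · rw [letter_le_iff]
    intro q hq p hp hlt
    exact lt_letter (Finset.mem_of_mem_erase hq) hp (hb ▸ hlt)
  · rw [letter_le_iff]
    intro q hq p hp hlt
    by_cases h : q = pivot c
    · subst h
      obtain rfl | hp := hc.mem_graph_pivot.1 hp
      · exact (lt_irrefl _ hlt).elim
      · obtain ⟨q, hq, hq', hp⟩ := mem_low.1 hp
        exact lt_letter (Finset.mem_erase.2 ⟨hc.ne_pivot hq', hq⟩) hp (hb ▸ hlt)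
    · exact lt_letter (Finset.mem_erase.2 ⟨h, hq⟩) hp (hb ▸ hlt)

lemma IsFull.low_erase (hc : IsFull c) : low (c.erase (pivot c)) = low c := by
  ext p
  rw [mem_low, mem_low, hc.letter_erase, bot_congr hc.verts_erase]
  constructor
  · rintro ⟨q, hq, h⟩
    exact ⟨q, Finset.mem_of_mem_erase hq, h⟩
  · rintro ⟨q, hq, h⟩
    exact ⟨q, Finset.mem_erase.2 ⟨hc.ne_pivot h.1, hq⟩, h⟩

lemma IsFull.pivot_erase (hc : IsFull c) : pivot (c.erase (pivot c)) = pivot c :=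
  pivot_congr (bot_congr hc.verts_erase) hc.letter_erase hc.low_erase

lemma IsFull.insert_pivot (hc : IsFull c) : IsFull (insert (pivot c) c) where
  chain := by
    rw [Finset.coe_insert]
    refine hc.chain.insert fun q hq _ => ?_
    obtain ⟨G, hG, hmem⟩ := hc.pivot_eq
    rw [hG]
    cases q with
    | vertex i =>
      refine Or.inl fun p hp => ?_
      refine le_trans ?_ (bot_le hq)
      obtain rfl | hp := (hmem p).1 hp
      · exact le_rfl
      · obtain ⟨q, hq, -, hp⟩ := mem_low.1 hp
        exact hc.snd_le_bot hq hp
    | word G' =>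
      by_cases h : (letter c, bot c) ∈ G'.graph
      · refine Or.inl fun p hp => ?_
        obtain rfl | hp := (hmem p).1 hp
        · exact h
        · obtain ⟨q, hq₁, hq', hp⟩ := mem_low.1 hp
          obtain h' | h' := hc.total hq hq₁
          · exact (hq' (h' h)).elim
          · exact h' hp
      · exact Or.inr fun p hp => (hmem p).2 (Or.inr (mem_low.2 ⟨_, hq, h, hp⟩))
  exists_vertex := ⟨_, Finset.mem_insert_of_mem hc.bot_mem⟩
  tags i := by
    obtain ⟨q, hq, hi⟩ := hc.tags i
    exact ⟨q, Finset.mem_insert_of_mem hq, hi⟩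

lemma IsFull.erase_pivot (hc : IsFull c) : IsFull (c.erase (pivot c)) where
  chain := hc.chain.mono (Finset.coe_subset.2 (Finset.erase_subset _ _))
  exists_vertex := ⟨bot c, by rw [← mem_verts, hc.verts_erase, mem_verts]; exact hc.bot_mem⟩
  tags i := by
    have hb : vertex (bot c) ∈ c.erase (pivot c) := by
      rw [← mem_verts, hc.verts_erase, mem_verts]; exact hc.bot_mem
    obtain ⟨q, hq, hi⟩ := hc.tags i
    by_cases h : q = pivot c
    · obtain ⟨G, hG, hmem⟩ := hc.pivot_eq
      rw [h, hG] at hi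
      obtain ⟨p, hp, rfl⟩ := Finset.mem_image.1 hi
      obtain rfl | hp := (hmem p).1 hp
      · exact ⟨_, hb, by simp [CappedWord.tags]⟩
      · obtain ⟨q', hq, hq', hp⟩ := mem_low.1 hp
        refine ⟨q', Finset.mem_erase.2 ⟨hc.ne_pivot hq', hq⟩, ?_⟩
        cases q' with
        | word G' => exact Finset.mem_image_of_mem _ hp
        | vertex i => simp [graph] at hp
    · exact ⟨q, Finset.mem_erase.2 ⟨h, hq⟩, hi⟩

open scoped Classical in
/-- The rank used to show that the pairing given by `pivot` is regular. -/
noncomputable def rank (c : Finset (CappedWord.{w} m)) : ℕ ×ₗ ℕ ×ₗ ℕ :=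
  toLex ((verts c).card, toLex (letter c,
    (c.filter fun q => (∃ G, q = word G) ∧ (letter c, bot c) ∉ q.graph).card))

open scoped Classical in
lemma IsFull.rank_lt (hc : IsFull c) (hp : pivot c ∉ c) {x : CappedWord.{w} m} (hx : x ∈ c)
    (h : pivot ((insert (pivot c) c).erase x) ∉ (insert (pivot c) c).erase x) :
    rank ((insert (pivot c) c).erase x) < rank c := by
  simp only [rank, Prod.Lex.toLex_lt_toLex]
  cases x with
  | vertex i =>
    refine Or.inl (Finset.card_lt_card ?_)
    rw [Finset.ssubset_iff_of_subset]
    · exact ⟨i, mem_verts.2 hx, by simp [mem_verts]⟩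
    · rw [← hc.verts_insert]
      intro j hj
      rw [mem_verts] at hj ⊢
      exact Finset.mem_of_mem_erase hj
  | word G =>
    have hv : verts ((insert (pivot c) c).erase (word G)) = verts c := by
      rw [verts_erase_word, hc.verts_insert]
    have hb := bot_congr hv
    have hne : word G ≠ pivot c := fun h => hp (h ▸ hx)
    refine Or.inr ⟨congrArg Finset.card hv, ?_⟩
    have hl : letter ((insert (pivot c) c).erase (word G)) ≤ letter c := by
      rw [letter_le_iff, hb]
      intro q hq p hp hlt
      rw [← bot_congr hc.verts_insert] at hlt
      have := lt_letter (Finset.mem_of_mem_erase hq) hp hlt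
      rwa [hc.letter_insert] at this
    refine hl.lt_or_eq.imp id fun hl => ⟨hl, ?_⟩
    have hG : (letter c, bot c) ∉ G.graph := by
      intro hG
      refine h ?_
      have hlow : low ((insert (pivot c) c).erase (word G)) = low c := by
        rw [← hc.low_insert]
        ext p
        rw [mem_low, mem_low, hl, hb, hc.letter_insert, bot_congr hc.verts_insert]
        constructor
        · rintro ⟨q, hq, h⟩
          exact ⟨q, Finset.mem_of_mem_erase hq, h⟩
        · rintro ⟨q, hq, h⟩
          refine ⟨q, Finset.mem_erase.2 ⟨?_, hq⟩, h⟩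
          rintro rfl
          exact h.1 hG
      rw [pivot_congr hb hl hlow]
      exact Finset.mem_erase.2 ⟨hne.symm, Finset.mem_insert_self _ _⟩
    apply Finset.card_lt_card
    rw [hl, hb]
    rw [Finset.ssubset_iff_of_subset]
    · exact ⟨word G, Finset.mem_filter.2 ⟨hx, ⟨G, rfl⟩, hG⟩, by simp⟩
    · intro q hq
      have hq := Finset.mem_filter.1 hq
      rw [Finset.mem_erase, Finset.mem_insert] at hq
      apply Finset.mem_filter.2
      refine ⟨hq.1.2.resolve_left ?_, hq.2⟩
      exact hc.ne_pivot hq.2.2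

theorem anodyneExtensions_boundary (m : SimplexCategory) :
    SSet.anodyneExtensions (boundary.{w} m).ι := by
  classical
  refine anodyneExtensions_of_toggle _ IsFull (fun _ => notMem_boundary_iff)
    (fun c hc => ⟨hc.chain, _, hc.bot_mem⟩) pivot ?_ ?_ ?_ ?_ rank ?_
  · intro c hc
    convert hc.insert_pivot
  · intro c hc _
    convert hc.erase_pivot
  · intro c hc
    convert hc.pivot_insert
  · intro c hc _
    convert hc.pivot_erase
  · intro c hc hp x hx _ h
    convert hc.rank_lt hp hx (by convert h)

end CappedWord

end TaggedWords

section CosimplicialPosets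

/-- The map on nerves induced by a monotone map. -/
def nerveHom {P Q : Type w} [Preorder P] [Preorder Q] (f : P →o Q) : nerve P ⟶ nerve Q :=
  nerveMap f.monotone.functor

lemma nerve_ext {P : Type w} [Preorder P] {n : SimplexCategoryᵒᵖ} {x y : (nerve P).obj n}
    (h : ∀ i, x.obj i = y.obj i) : x = y :=
  CategoryTheory.Functor.ext h fun _ _ _ => Subsingleton.elim _ _

namespace TaggedWord

variable {m m' : SimplexCategory}

/-- Change of tags. -/
def map (θ : m ⟶ m') : TaggedWord.{w} m →o TaggedWord.{w} m' where
  toFun G :=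
    { graph := G.graph.image (Prod.map id θ.toOrderHom)
      nonempty := G.nonempty.image _
      mono := by
        intro p hp q hq h
        obtain ⟨p', hp', rfl⟩ := Finset.mem_image.1 hp
        obtain ⟨q', hq', rfl⟩ := Finset.mem_image.1 hq
        exact θ.toOrderHom.monotone (G.mono p' hp' q' hq' h) }
  monotone' _ _ h := Finset.image_subset_image h

lemma graph_map (θ : m ⟶ m') (G : TaggedWord.{w} m) :
    (map θ G).graph = G.graph.image (Prod.map id θ.toOrderHom) := rfl

@[simp] lemma map_id (G : TaggedWord.{w} m) : map (𝟙 m) G = G := by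
  ext p
  simp [graph_map]

@[simp] lemma map_comp {m'' : SimplexCategory} (θ : m ⟶ m') (θ' : m' ⟶ m'')
    (G : TaggedWord.{w} m) : map (θ ≫ θ') G = map θ' (map θ G) := by
  apply TaggedWord.ext
  simp only [graph_map, Finset.image_image]
  rfl

/-- The last tag of a word. -/
noncomputable def last (m : SimplexCategory) : TaggedWord.{w} m →o Fin (m.len + 1) where
  toFun G := G.graph.sup Prod.snd
  monotone' _ _ h := Finset.sup_mono h

lemma le_last {G : TaggedWord.{w} m} {p : ℕ × Fin (m.len + 1)} (hp : p ∈ G.graph) :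
    p.2 ≤ last m G := Finset.le_sup (f := Prod.snd) hp

lemma last_map (θ : m ⟶ m') (G : TaggedWord.{w} m) :
    last m' (map θ G) = θ.toOrderHom (last m G) := by
  apply le_antisymm
  · refine Finset.sup_le fun p hp => ?_
    obtain ⟨q, hq, rfl⟩ := Finset.mem_image.1 hp
    exact θ.toOrderHom.monotone (le_last hq)
  · obtain ⟨p, hp, h⟩ := Finset.exists_mem_eq_sup _ G.nonempty (Prod.snd)
    have h : last m G = p.2 := h
    rw [h]
    exact le_last (G := map θ G) (Finset.mem_image_of_mem _ hp)

end TaggedWord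

namespace CappedWord

variable {m m' : SimplexCategory}

/-- Change of tags. -/
def map (θ : m ⟶ m') : CappedWord.{w} m →o CappedWord.{w} m' where
  toFun q := q.casesOn (fun G => word (G.map θ)) (fun i => vertex (θ.toOrderHom i))
  monotone' q q' h := by
    cases q <;> cases q'
    · exact (TaggedWord.map θ).monotone h
    · intro p hp
      obtain ⟨p', hp', rfl⟩ := Finset.mem_image.1 hp
      exact θ.toOrderHom.monotone (h p' hp')
    · exact h.elim
    · exact θ.toOrderHom.monotone h

@[simp] lemma map_word (θ : m ⟶ m') (G : TaggedWord.{w} m) :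
    map θ (word G) = word (G.map θ) := rfl

@[simp] lemma map_vertex (θ : m ⟶ m') (i : Fin (m.len + 1)) :
    map θ (vertex i : CappedWord.{w} m) = vertex (θ.toOrderHom i) := rfl

@[simp] lemma map_id (q : CappedWord.{w} m) : map (𝟙 m) q = q := by
  cases q <;> simp

@[simp] lemma map_comp {m'' : SimplexCategory} (θ : m ⟶ m') (θ' : m' ⟶ m'')
    (q : CappedWord.{w} m) : map (θ ≫ θ') q = map θ' (map θ q) := by
  cases q <;> simp

/-- The inclusion of words. -/
def ofWord (m : SimplexCategory) : TaggedWord.{w} m →o CappedWord.{w} m where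
  toFun := word
  monotone' _ _ h := h

/-- The last tag of a capped word. -/
noncomputable def last (m : SimplexCategory) : CappedWord.{w} m →o Fin (m.len + 1) where
  toFun q := q.casesOn (TaggedWord.last m) id
  monotone' q q' h := by
    cases q <;> cases q'
    · exact (TaggedWord.last m).monotone h
    · exact Finset.sup_le h
    · exact h.elim
    · exact h

lemma last_map (θ : m ⟶ m') (q : CappedWord.{w} m) :
    last m' (map θ q) = θ.toOrderHom (last m q) := by
  cases q
  · exact TaggedWord.last_map _ _
  · rfl

lemma map_le_map_iff (θ : m ⟶ m') (hθ : Function.Injective θ.toOrderHom)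
    {q q' : CappedWord.{w} m} : map θ q ≤ map θ q' ↔ q ≤ q' := by
  refine ⟨fun h => ?_, fun h => (map θ).monotone h⟩
  have hs : StrictMono θ.toOrderHom := θ.toOrderHom.monotone.strictMono_of_injective hθ
  cases q <;> cases q'
  · exact (Finset.image_subset_image_iff (Function.injective_id.prodMap hθ)).1 h
  · exact fun p hp => hs.le_iff_le.1 (h _ (Finset.mem_image_of_mem _ hp))
  · exact h.elim
  · exact hs.le_iff_le.1 h

lemma map_injective (θ : m ⟶ m') (hθ : Function.Injective θ.toOrderHom) :
    Function.Injective (map.{w} θ) := fun _ _ h =>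
  le_antisymm ((map_le_map_iff θ hθ).1 h.le) ((map_le_map_iff θ hθ).1 h.ge)

lemma exists_map_eq (θ : m ⟶ m') {q : CappedWord.{w} m'}
    (hq : ∀ i ∈ q.tags, i ∈ Set.range θ.toOrderHom) (hθ : Function.Injective θ.toOrderHom) :
    ∃ q', map θ q' = q := by
  cases q with
  | vertex i =>
    obtain ⟨j, rfl⟩ := hq i (by simp [tags])
    exact ⟨vertex j, rfl⟩
  | word G =>
    have hs : StrictMono θ.toOrderHom := θ.toOrderHom.monotone.strictMono_of_injective hθ
    have hG : ∀ p ∈ G.graph, ∃ i, θ.toOrderHom i = p.2 := fun p hp =>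
      hq p.2 (Finset.mem_image_of_mem _ hp)
    let G₀ := G.graph.preimage (Prod.map id θ.toOrderHom)
      (Function.injective_id.prodMap hθ).injOn
    have hG₀ : G₀.image (Prod.map id θ.toOrderHom) = G.graph := by
      ext p
      simp only [G₀, Finset.mem_image, Finset.mem_preimage]
      constructor
      · rintro ⟨p, hp, rfl⟩
        exact hp
      · intro hp
        obtain ⟨i, hi⟩ := hG p hp
        have : Prod.map id θ.toOrderHom (p.1, i) = p := Prod.ext rfl hi
        exact ⟨(p.1, i), this ▸ hp, this⟩
    refine ⟨word ⟨G₀, ?_, fun p hp q hq h => ?_⟩, congrArg word (TaggedWord.ext hG₀)⟩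
    · rw [← Finset.image_nonempty (f := Prod.map id θ.toOrderHom), hG₀]
      exact G.nonempty
    · exact hs.le_iff_le.1 (G.mono _ (Finset.mem_preimage.1 hp) _ (Finset.mem_preimage.1 hq) h)

lemma mem_range_of_mem_tags_map (θ : m ⟶ m') {q : CappedWord.{w} m} {i : Fin (m'.len + 1)}
    (hi : i ∈ (map θ q).tags) : i ∈ Set.range θ.toOrderHom := by
  cases q with
  | vertex j => exact ⟨j, (Finset.mem_singleton.1 hi).symm⟩
  | word G =>
    obtain ⟨p, hp, rfl⟩ := Finset.mem_image.1 hi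
    obtain ⟨p, -, rfl⟩ := Finset.mem_image.1 hp
    exact ⟨p.2, rfl⟩

lemma tags_nonempty (q : CappedWord.{w} m) : q.tags.Nonempty := by
  cases q with
  | vertex j => exact ⟨j, Finset.mem_singleton_self _⟩
  | word G => exact G.nonempty.image _

lemma exists_nerveHom_map_eq (θ : m ⟶ m') (hθ : Function.Injective θ.toOrderHom)
    {n : SimplexCategoryᵒᵖ} (x : (nerve (CappedWord.{w} m')).obj n)
    (hx : ∀ k, ∀ i ∈ (x.obj k).tags, i ∈ Set.range θ.toOrderHom) :
    ∃ y, (nerveHom (map θ)).app n y = x := by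
  choose f hf using fun k => exists_map_eq θ (hx k) hθ
  have hmono : Monotone f := fun i j hij => by
    rw [← map_le_map_iff θ hθ, hf, hf]
    exact x.monotone hij
  exact ⟨hmono.functor, nerve_ext hf⟩

lemma nerveHom_map_injective (θ : m ⟶ m') (hθ : Function.Injective θ.toOrderHom)
    {n : SimplexCategoryᵒᵖ} {x y : (nerve (CappedWord.{w} m)).obj n}
    (h : (nerveHom (map θ)).app n x = (nerveHom (map θ)).app n y) : x = y :=
  nerve_ext fun i => map_injective θ hθ (congrArg (fun z => z.obj i) h)

end CappedWord

/-- The cosimplicial simplicial set of nerves of tagged words. -/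
def wordNerve : SimplexCategory ⥤ SSet.{w} where
  obj m := nerve (TaggedWord.{w} m)
  map θ := nerveHom (TaggedWord.map θ)
  map_id m := by
    ext n x : 4
    refine nerve_ext (P := TaggedWord m) fun i => ?_
    exact TaggedWord.map_id (x.obj i)
  map_comp {_ _ m} θ θ' := by
    ext n x : 4
    refine nerve_ext (P := TaggedWord m) fun i => ?_
    exact TaggedWord.map_comp θ θ' (x.obj i)

/-- The cosimplicial simplicial set of nerves of capped words. -/
def cappedNerve : SimplexCategory ⥤ SSet.{w} where
  obj m := nerve (CappedWord.{w} m)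
  map θ := nerveHom (CappedWord.map θ)
  map_id m := by
    ext n x : 4
    refine nerve_ext (P := CappedWord m) fun i => ?_
    exact CappedWord.map_id (x.obj i)
  map_comp {_ _ m} θ θ' := by
    ext n x : 4
    refine nerve_ext (P := CappedWord m) fun i => ?_
    exact CappedWord.map_comp θ θ' (x.obj i)

/-- The inclusion of words into capped words. -/
def wordNerveι : wordNerve.{w} ⟶ cappedNerve where
  app m := nerveHom (CappedWord.ofWord m)

/-- The simplicial set of families of simplices indexed by tagged words. -/
def wordComplex (K : SSet.{w}) : SSet.{w} := wordNerve.op ⋙ yoneda.obj K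

/-- The simplicial set of families of simplices indexed by capped words. -/
def cappedComplex (K : SSet.{w}) : SSet.{w} := cappedNerve.op ⋙ yoneda.obj K

/-- Restriction from capped words to words. -/
def cappedRestrict (K : SSet.{w}) : cappedComplex K ⟶ wordComplex K where
  app m := ↾fun f => wordNerveι.app m.unop ≫ f

end CosimplicialPosets

section CappedRestrict

lemma exists_glue {X K : SSet.{w}} (A : X.Subcomplex) {ι : Type*} (Y : ι → SSet.{w})
    (φ : ∀ a, Y a ⟶ X) (τ : ∀ a, Y a ⟶ K)
    (hcover : ∀ n, ∀ x ∈ A.obj n, ∃ a y, (φ a).app n y = x)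
    (hcompat : ∀ a b n y y', (φ a).app n y = (φ b).app n y' → (τ a).app n y = (τ b).app n y') :
    ∃ g : (A : SSet.{w}) ⟶ K, ∀ a n y (h : (φ a).app n y ∈ A.obj n),
      g.app n ⟨_, h⟩ = (τ a).app n y := by
  choose f y hf using hcover
  let g : (A : SSet.{w}) ⟶ K :=
    { app n := ↾fun x => (τ (f n x.1 x.2)).app n (y n x.1 x.2)
      naturality n n' θ := by
        ext x
        change (τ _).app n' _ = K.map θ ((τ _).app n _)
        rw [← ConcreteCategory.comp_apply, ← (τ _).naturality, ConcreteCategory.comp_apply]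
        apply hcompat
        rw [hf, ← ConcreteCategory.comp_apply, (φ _).naturality, ConcreteCategory.comp_apply, hf]
        rfl }
  exact ⟨g, fun a n z h => hcompat _ _ _ _ _ (hf _ _ _)⟩

lemma exists_hom_range_eq {m : SimplexCategory} (S : Finset (Fin (m.len + 1))) (hS : S.Nonempty) :
    ∃ (k : SimplexCategory) (δ : k ⟶ m), Function.Injective δ.toOrderHom ∧
      Set.range δ.toOrderHom = S := by
  have hc : S.card = (S.card - 1) + 1 := by have := hS.card_pos; omega
  refine ⟨⦋S.card - 1⦌, SimplexCategory.Hom.mk (S.orderEmbOfFin hc).toOrderHom,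
    (S.orderEmbOfFin hc).injective, S.range_orderEmbOfFin hc⟩

lemma exists_comp_eq {k l m : SimplexCategory} (δ : k ⟶ m) (θ : l ⟶ m)
    (hδ : Function.Injective δ.toOrderHom)
    (h : Set.range θ.toOrderHom ⊆ Set.range δ.toOrderHom) : ∃ κ : l ⟶ k, κ ≫ δ = θ := by
  have hs : StrictMono δ.toOrderHom := δ.toOrderHom.monotone.strictMono_of_injective hδ
  choose f hf using fun i => h ⟨i, rfl⟩
  refine ⟨SimplexCategory.Hom.mk ⟨f, fun i j hij => ?_⟩, ?_⟩
  · rw [← hs.le_iff_le, hf, hf]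
    exact θ.toOrderHom.monotone hij
  · ext i : 3
    exact hf i

/-- The set of all tags of a chain. -/
noncomputable def CappedWord.allTags {m : SimplexCategory} {n : SimplexCategoryᵒᵖ}
    (x : (nerve (CappedWord.{w} m)).obj n) : Finset (Fin (m.len + 1)) :=
  Finset.univ.biUnion fun k => (x.obj k).tags

lemma CappedWord.allTags_nonempty {m : SimplexCategory} {n : SimplexCategoryᵒᵖ}
    (x : (nerve (CappedWord.{w} m)).obj n) : (allTags x).Nonempty := by
  obtain ⟨i, hi⟩ := CappedWord.tags_nonempty (x.obj 0)
  exact ⟨i, Finset.mem_biUnion.2 ⟨0, Finset.mem_univ _, hi⟩⟩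

lemma CappedWord.allTags_nerveHom_map_subset {k m : SimplexCategory} (θ : k ⟶ m)
    {n : SimplexCategoryᵒᵖ} (x : (nerve (CappedWord.{w} k)).obj n) :
    (allTags ((nerveHom (map θ)).app n x) : Set (Fin (m.len + 1))) ⊆ Set.range θ.toOrderHom := by
  intro i hi
  obtain ⟨j, -, hj⟩ := Finset.mem_biUnion.1 hi
  exact mem_range_of_mem_tags_map θ hj

open scoped SSet.modelCategoryQuillen in
lemma exists_extension {K : SSet.{w}} (hK : SSet.KanComplex K) {m : SimplexCategory}
    (γ : wordNerve.obj m ⟶ K)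
    (β : ∀ k (θ : k ⟶ m), ¬ Function.Surjective θ.toOrderHom → (cappedNerve.obj k ⟶ K))
    (hβ : ∀ l k (κ : l ⟶ k) (θ : k ⟶ m) h h', β l (κ ≫ θ) h = cappedNerve.map κ ≫ β k θ h')
    (hγ : ∀ k (θ : k ⟶ m) h, wordNerveι.app k ≫ β k θ h = wordNerve.map θ ≫ γ) :
    ∃ g : cappedNerve.obj m ⟶ K, wordNerveι.app m ≫ g = γ ∧
      ∀ k (θ : k ⟶ m) h, cappedNerve.map θ ≫ g = β k θ h := by
  let ι := Option (Σ k : SimplexCategory, {θ : k ⟶ m //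
    Function.Injective θ.toOrderHom ∧ ¬ Function.Surjective θ.toOrderHom})
  let Y : ι → SSet.{w} := fun a => a.elim (wordNerve.obj m) fun a => cappedNerve.obj a.1
  let φ : ∀ a, Y a ⟶ nerve (CappedWord.{w} m) := fun a =>
    match a with
    | none => wordNerveι.app m
    | some a => cappedNerve.map a.2.1
  let τ : ∀ a, Y a ⟶ K := fun a =>
    match a with
    | none => γ
    | some a => β a.1 a.2.1 a.2.2.2
  have hwc : ∀ (a : Σ k : SimplexCategory, {θ : k ⟶ m //
      Function.Injective θ.toOrderHom ∧ ¬ Function.Surjective θ.toOrderHom})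
      (n : SimplexCategoryᵒᵖ) (y : (wordNerve.{w}.obj m).obj n) (y' : (cappedNerve.obj a.1).obj n),
      (wordNerveι.app m).app n y = (cappedNerve.map a.2.1).app n y' →
      γ.app n y = (β a.1 a.2.1 a.2.2.2).app n y' := by
    rintro ⟨k, θ, hθ, hθ'⟩ n y y' h
    have hw : ∀ j, ∃ G, y'.obj j = CappedWord.word G := by
      intro j
      have h : CappedWord.word (y.obj j) = CappedWord.map θ (y'.obj j) :=
        congrArg (fun z => z.obj j) h
      cases hj : y'.obj j with
      | word G => exact ⟨G, rfl⟩
      | vertex i => rw [hj] at h; cases h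
    choose G hG using hw
    have hGm : Monotone G := fun i j hij => by
      have := y'.monotone hij
      rw [hG, hG] at this
      exact this
    obtain rfl : (wordNerveι.app k).app n hGm.functor = y' :=
      nerve_ext (P := CappedWord k) fun i => (hG i).symm
    obtain rfl : (wordNerve.map θ).app n hGm.functor = y :=
      nerve_ext (P := TaggedWord m) fun i =>
        CappedWord.word.inj (congrArg (fun z => z.obj i) h).symm
    have := congrArg (fun f => f.app n hGm.functor) (hγ k θ hθ')
    exact this.symm
  have hcc : ∀ (a b : Σ k : SimplexCategory, {θ : k ⟶ m //
      Function.Injective θ.toOrderHom ∧ ¬ Function.Surjective θ.toOrderHom})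
      (n : SimplexCategoryᵒᵖ) (y : (cappedNerve.{w}.obj a.1).obj n)
      (y' : (cappedNerve.obj b.1).obj n),
      (cappedNerve.map a.2.1).app n y = (cappedNerve.map b.2.1).app n y' →
      (β a.1 a.2.1 a.2.2.2).app n y = (β b.1 b.2.1 b.2.2.2).app n y' := by
    rintro ⟨k, θ, hθ, hθ'⟩ ⟨k', θ', hθi, hθi'⟩ n y y' h
    obtain ⟨l, δ, hδ, hr⟩ := exists_hom_range_eq _
      (CappedWord.allTags_nonempty ((nerveHom (CappedWord.map θ)).app n y))
    have hrθ : Set.range δ.toOrderHom ⊆ Set.range θ.toOrderHom :=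
      hr.trans_subset (CappedWord.allTags_nerveHom_map_subset θ y)
    have hrθ' : Set.range δ.toOrderHom ⊆ Set.range θ'.toOrderHom := by
      have h : (nerveHom (CappedWord.map θ)).app n y = (nerveHom (CappedWord.map θ')).app n y' := h
      rw [hr, h]
      exact CappedWord.allTags_nerveHom_map_subset θ' y'
    obtain ⟨κ, rfl⟩ := exists_comp_eq θ δ hθ hrθ
    obtain ⟨κ', hκ'⟩ := exists_comp_eq θ' (κ ≫ θ) hθi hrθ'
    obtain ⟨z, hz⟩ := CappedWord.exists_nerveHom_map_eq (κ ≫ θ) hδ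
      ((nerveHom (CappedWord.map θ)).app n y) fun j i hi => by
        rw [hr]
        exact Finset.mem_biUnion.2 ⟨j, Finset.mem_univ _, hi⟩
    have hy : (cappedNerve.map κ).app n z = y := by
      apply CappedWord.nerveHom_map_injective θ hθ
      rw [← hz]
      exact (congrArg (fun f => f.app n z) (cappedNerve.map_comp κ θ)).symm
    have hy' : (cappedNerve.map κ').app n z = y' := by
      apply CappedWord.nerveHom_map_injective θ' hθi
      refine Eq.trans ?_ (hz.trans h)
      refine (congrArg (fun f => f.app n z) (cappedNerve.map_comp κ' θ')).symm.trans ?_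
      rw [hκ']
      rfl
    have hns : ¬ Function.Surjective (κ ≫ θ).toOrderHom := fun hs => hθ' fun i => by
      obtain ⟨j, rfl⟩ := hs i
      exact ⟨κ.toOrderHom j, rfl⟩
    subst hy hy'
    have e₁ := congrArg (fun f => f.app n z) (hβ _ _ κ θ hns hθ')
    have e₂ := congrArg (fun f => f.app n z) (hβ _ _ κ' θ' (by rwa [hκ']) hθi')
    refine Eq.trans e₁.symm (Eq.trans ?_ e₂)
    have key : ∀ (θ₁ θ₂ : l ⟶ m) (_ : θ₁ = θ₂) h h', β l θ₁ h = β l θ₂ h' := by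
      rintro θ₁ _ rfl h h'
      rfl
    rw [key _ _ hκ'.symm]
  obtain ⟨g₀, hg₀⟩ := exists_glue (CappedWord.boundary.{w} m) Y φ τ (by
    rintro n x (hx | ⟨i, hi⟩)
    · choose G hG using hx
      have hGm : Monotone G := fun i j hij => by
        have := x.monotone hij
        rw [hG, hG] at this
        exact this
      exact ⟨none, hGm.functor, nerve_ext (P := CappedWord m) fun i => (hG i).symm⟩
    · obtain ⟨k, θ, hθ, hr⟩ := exists_hom_range_eq _ (CappedWord.allTags_nonempty x)
      obtain ⟨y, hy⟩ := CappedWord.exists_nerveHom_map_eq θ hθ x fun j i hi => by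
        rw [hr]
        exact Finset.mem_biUnion.2 ⟨j, Finset.mem_univ _, hi⟩
      refine ⟨some ⟨k, θ, hθ, fun hs => ?_⟩, y, hy⟩
      have : i ∈ Set.range θ.toOrderHom := hs i
      rw [hr] at this
      obtain ⟨j, -, hj⟩ := Finset.mem_biUnion.1 this
      exact hi j hj) (by
    rintro (_ | a) (_ | b) n y y' h
    · obtain rfl : y = y' := nerve_ext (P := TaggedWord m) fun i =>
        CappedWord.word.inj (congrArg (fun z => z.obj i) h)
      rfl
    · exact hwc b n y y' h
    · exact (hwc a n y' y h.symm).symm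
    · exact hcc a b n y y' h)
  have hlift : HasLiftingProperty (CappedWord.boundary.{w} m).ι (terminal.from K) :=
    CappedWord.anodyneExtensions_boundary m _ ((HomotopicalAlgebra.isFibrant_iff K).1 hK).mem
  have sq : CommSq g₀ (CappedWord.boundary.{w} m).ι (terminal.from K) (terminal.from _) :=
    ⟨terminal.hom_ext _ _⟩
  have hl : ∀ n (x : (nerve (CappedWord.{w} m)).obj n) (hx : x ∈ (CappedWord.boundary m).obj n),
      sq.lift.app n x = g₀.app n ⟨x, hx⟩ := fun n x hx =>
    congrArg (fun f => f.app n ⟨x, hx⟩) sq.fac_left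
  have hm : ∀ k (θ : k ⟶ m), ¬ Function.Surjective θ.toOrderHom →
      ∀ n (y : (cappedNerve.obj k).obj n), (cappedNerve.map θ).app n y ∈
        (CappedWord.boundary.{w} m).obj n := by
    intro k θ h n y
    obtain ⟨i, hi⟩ := not_forall.1 h
    refine Or.inr ⟨i, fun j hj => ?_⟩
    obtain ⟨i', hi'⟩ := CappedWord.mem_range_of_mem_tags_map θ hj
    exact hi ⟨i', hi'⟩
  refine ⟨sq.lift, ?_, fun k θ h => ?_⟩
  · ext n y
    exact (hl n _ (Or.inl fun k => ⟨_, rfl⟩)).trans (hg₀ none n y _)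
  · obtain ⟨l, δ, hδ, hr⟩ := exists_hom_range_eq (Finset.univ.image θ.toOrderHom) (by simp)
    obtain ⟨κ, rfl⟩ := exists_comp_eq δ θ hδ (by simp [hr])
    have hns : ¬ Function.Surjective δ.toOrderHom := fun hs => h fun i => by
      have : i ∈ Set.range δ.toOrderHom := hs i
      simpa [hr] using this
    rw [hβ k l κ δ h hns, Functor.map_comp]
    refine (Category.assoc (cappedNerve.map κ) (cappedNerve.map δ) sq.lift).trans ?_
    refine congrArg (cappedNerve.map κ ≫ ·) ?_
    ext n y
    exact (hl n _ (hm l δ hns n y)).trans (hg₀ (some ⟨l, δ, hδ, hns⟩) n y _)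

lemma rlp_cappedRestrict {K : SSet.{w}} (hK : SSet.KanComplex K) :
    (MorphismProperty.monomorphisms SSet.{w}).rlp (cappedRestrict K) := by
  rw [SSet.rlp_monomorphisms]
  rintro _ _ _ ⟨m⟩
  refine ⟨fun {b t} sq => ?_⟩
  have hmem : ∀ k (θ : k ⟶ ⦋m⦌), ¬ Function.Surjective θ.toOrderHom →
      SSet.stdSimplex.objEquiv.symm θ ∈ (SSet.boundary.{w} m).obj (.op k) := fun k θ h => h
  obtain ⟨g, hg, hg'⟩ := exists_extension hK (m := ⦋m⦌)
    (t.app (.op ⦋m⦌) (SSet.stdSimplex.objEquiv.symm (𝟙 _)))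
    (fun k θ h => b.app (.op k) ⟨SSet.stdSimplex.objEquiv.symm θ, hmem k θ h⟩)
    (fun l k κ θ h h' => by
      have := congrArg (fun f => f ⟨SSet.stdSimplex.objEquiv.symm θ, hmem k θ h'⟩)
        (b.naturality κ.op)
      exact this)
    (fun k θ h => by
      have h₁ := congrArg (fun f => f.app (.op k) ⟨SSet.stdSimplex.objEquiv.symm θ, hmem k θ h⟩)
        sq.w
      have h₂ := congrArg (fun f => f (SSet.stdSimplex.objEquiv.symm (𝟙 ⦋m⦌)))
        (t.naturality θ.op)
      refine Eq.trans h₁ (Eq.trans ?_ h₂)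
      change t.app (.op k) _ = t.app (.op k) _
      refine congrArg (fun x => t.app (.op k) x) ?_
      change SSet.stdSimplex.objEquiv.symm θ = _
      refine Eq.trans ?_ (SSet.stdSimplex.map_objEquiv_symm (𝟙 ⦋m⦌) θ.op).symm
      exact congrArg _ (Category.comp_id θ).symm)
  refine ⟨⟨⟨SSet.yonedaEquiv.symm g, ?_, ?_⟩⟩⟩
  · ext k ⟨x, hx⟩
    obtain ⟨θ, rfl⟩ := SSet.stdSimplex.objEquiv.symm.surjective x
    refine Eq.trans ?_ (hg' k.unop θ hx)
    exact SSet.yonedaEquiv_symm_app_objEquiv_symm (X := cappedComplex K) (n := ⦋m⦌) g θ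
  · refine (SSet.yonedaEquiv_symm_comp (X := cappedComplex K) (n := ⦋m⦌) g
      (cappedRestrict K)).trans ?_
    rw [Equiv.symm_apply_eq]
    exact hg

end CappedRestrict

lemma hom_ext_apply {X Y : SSet.{w}} {f g : X ⟶ Y} (h : ∀ n x, f.app n x = g.app n x) :
    f = g := by
  ext n x
  exact h n x

section Homotopies

open MonoidalCategory CartesianMonoidalCategory

variable {X Y Z : SSet.{w}}

lemma SHomotopy.of_tensor {f g : X ⟶ Y} (H : X ⊗ Δ[1] ⟶ Y)
    (h₀ : lift (𝟙 X) (constVertex X 0) ≫ H = f) (h₁ : lift (𝟙 X) (constVertex X 1) ≫ H = g) :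
    SHomotopy f g := by
  have h (i : Fin 2) : prod.lift (𝟙 X) (constVertex X i) ≫ lift prod.fst prod.snd =
      lift (𝟙 X) (constVertex X i) := by
    ext1
    · rw [Category.assoc, lift_fst, lift_fst]
      exact prod.lift_fst _ _
    · rw [Category.assoc, lift_snd, lift_snd]
      exact prod.lift_snd _ _
  refine ⟨lift prod.fst prod.snd ≫ H, ?_, ?_⟩
  · rw [← Category.assoc, h, h₀]
  · rw [← Category.assoc, h, h₁]

lemma SHomotopy.exists_tensor {f g : X ⟶ Y} (h : SHomotopy f g) :
    ∃ H : X ⊗ Δ[1] ⟶ Y, lift (𝟙 X) (constVertex X 0) ≫ H = f ∧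
      lift (𝟙 X) (constVertex X 1) ≫ H = g := by
  obtain ⟨H, h₀, h₁⟩ := h
  have h (i : Fin 2) : lift (𝟙 X) (constVertex X i) ≫ prod.lift (fst X Δ[1]) (snd X Δ[1]) =
      prod.lift (𝟙 X) (constVertex X i) := by
    ext1 <;> simp
  refine ⟨prod.lift (fst X Δ[1]) (snd X Δ[1]) ≫ H, ?_, ?_⟩
  · rw [← Category.assoc, h, h₀]
  · rw [← Category.assoc, h, h₁]

lemma SHomotopy.of_family {f g : X ⟶ Y}
    (H : ∀ m : SimplexCategory, X.obj (.op m) → (m ⟶ ⦋1⦌) → Y.obj (.op m))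
    (hH : ∀ l m (θ : l ⟶ m) x t, Y.map θ.op (H m x t) = H l (X.map θ.op x) (θ ≫ t))
    (h₀ : ∀ m x, H m x (SimplexCategory.const m ⦋1⦌ 0) = f.app _ x)
    (h₁ : ∀ m x, H m x (SimplexCategory.const m ⦋1⦌ 1) = g.app _ x) : SHomotopy f g := by
  refine SHomotopy.of_tensor
    { app n := ↾fun x => H n.unop x.1 (SSet.stdSimplex.objEquiv x.2)
      naturality n n' θ := ?_ } ?_ ?_
  · ext x
    exact (hH _ _ θ.unop x.1 (SSet.stdSimplex.objEquiv x.2)).symm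
  · ext n x
    exact h₀ n.unop x
  · ext n x
    exact h₁ n.unop x

lemma SHomotopy.refl (f : X ⟶ Y) : SHomotopy f f :=
  SHomotopy.of_family (fun _ x _ => f.app _ x)
    (fun _ _ θ x _ => (congrArg (fun k => k x) (f.naturality θ.op)).symm)
    (fun _ _ => rfl) (fun _ _ => rfl)

lemma SHomotopy.precomp {f g : Y ⟶ Z} (h : SHomotopy f g) (e : X ⟶ Y) :
    SHomotopy (e ≫ f) (e ≫ g) := by
  obtain ⟨H, h₀, h₁⟩ := h
  have h (i : Fin 2) : prod.lift (𝟙 X) (constVertex X i) ≫ prod.map e (𝟙 _) =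
      e ≫ prod.lift (𝟙 Y) (constVertex Y i) := by
    rw [prod.lift_map, prod.comp_lift, Category.id_comp, Category.comp_id, Category.comp_id]
    rfl
  refine ⟨prod.map e (𝟙 _) ≫ H, ?_, ?_⟩
  · rw [← Category.assoc, h, Category.assoc, h₀]
  · rw [← Category.assoc, h, Category.assoc, h₁]

lemma SHomotopy.postcomp {f g : X ⟶ Y} (h : SHomotopy f g) (e : Y ⟶ Z) :
    SHomotopy (f ≫ e) (g ≫ e) := by
  obtain ⟨H, rfl, rfl⟩ := h
  exact ⟨H ≫ e, by simp, by simp⟩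

lemma Htpy.trans {f g h : X ⟶ Y} (h₁ : Htpy f g) (h₂ : Htpy g h) : Htpy f h :=
  Relation.EqvGen.trans _ _ _ h₁ h₂

lemma Htpy.symm {f g : X ⟶ Y} (h : Htpy f g) : Htpy g f := Relation.EqvGen.symm _ _ h

lemma SHomotopy.htpy {f g : X ⟶ Y} (h : SHomotopy f g) : Htpy f g := Relation.EqvGen.rel _ _ h

lemma Htpy.map {X' Y' : SSet.{w}} (F : (X ⟶ Y) → (X' ⟶ Y'))
    (hF : ∀ f g, SHomotopy f g → SHomotopy (F f) (F g)) {f g : X ⟶ Y} (h : Htpy f g) :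
    Htpy (F f) (F g) := by
  induction h with
  | rel f g h => exact (hF f g h).htpy
  | refl f => exact Relation.EqvGen.refl _
  | symm f g _ h => exact h.symm
  | trans f g k _ _ h h' => exact h.trans h'

lemma Htpy.precomp {f g : Y ⟶ Z} (h : Htpy f g) (e : X ⟶ Y) : Htpy (e ≫ f) (e ≫ g) :=
  h.map (e ≫ ·) fun _ _ h => h.precomp e

lemma Htpy.postcomp {f g : X ⟶ Y} (h : Htpy f g) (e : Y ⟶ Z) : Htpy (f ≫ e) (g ≫ e) :=
  h.map (· ≫ e) fun _ _ h => h.postcomp e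

/-- The ends of a cylinder. -/
def cylinderEnds (X : SSet.{w}) : (X ⊗ Δ[1]).Subcomplex where
  obj n := {x | ∃ i : Fin 2, x.2 = (constVertex X i).app n x.1}
  map := by
    rintro n n' θ x ⟨i, hi⟩
    refine ⟨i, ?_⟩
    exact (congrArg (Δ[1].map θ) hi).trans
      (congrArg (fun k => k x.1) ((constVertex X i).naturality θ)).symm

variable {E B : SSet.{w}} {p : E ⟶ B} (hp : (MorphismProperty.monomorphisms SSet.{w}).rlp p)

include hp

lemma exists_lift_of_rlp (f : X ⟶ B) : ∃ g : X ⟶ E, g ≫ p = f := by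
  obtain ⟨g₀, -⟩ := exists_glue (K := E) (⊥ : X.Subcomplex) (ι := Empty) (fun a => a.elim)
    (fun a => a.elim) (fun a => a.elim) (fun n x hx => hx.elim) (fun a => a.elim)
  have := hp (⊥ : X.Subcomplex).ι (MorphismProperty.monomorphisms.infer_property _)
  have sq : CommSq g₀ (⊥ : X.Subcomplex).ι p f := ⟨by
    ext n x
    exact x.2.elim⟩
  exact ⟨sq.lift, sq.fac_right⟩

lemma SHomotopy.of_comp_rlp {a b : X ⟶ E} (h : SHomotopy (a ≫ p) (b ≫ p)) : SHomotopy a b := by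
  obtain ⟨H, h₀, h₁⟩ := h.exists_tensor
  obtain ⟨g₀, hg₀⟩ := exists_glue (cylinderEnds X) (ι := Fin 2) (fun _ => X)
    (fun i => lift (𝟙 X) (constVertex X i)) ![a, b] (by
      rintro n x ⟨i, hi⟩
      exact ⟨i, x.1, Prod.ext rfl hi.symm⟩) (by
      intro i j n y y' h
      obtain rfl : y = y' := congrArg Prod.fst h
      have h' : SimplexCategory.const n.unop ⦋1⦌ i = SimplexCategory.const n.unop ⦋1⦌ j :=
        congrArg (fun z => ULift.down z.2) h
      obtain rfl : i = j := congrArg (fun (k : n.unop ⟶ ⦋1⦌) => k.toOrderHom 0) h'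
      rfl)
  have := hp (cylinderEnds X).ι (MorphismProperty.monomorphisms.infer_property _)
  have hmem : ∀ (i : Fin 2) n (x : X.obj n),
      (lift (𝟙 X) (constVertex X i)).app n x ∈ (cylinderEnds X).obj n := fun i n x => ⟨i, rfl⟩
  have sq : CommSq g₀ (cylinderEnds X).ι p H := ⟨by
    ext n ⟨x, i, hi⟩
    obtain ⟨y, rfl⟩ : ∃ y, x = (lift (𝟙 X) (constVertex X i)).app n y :=
      ⟨x.1, Prod.ext rfl hi⟩
    refine (congrArg (p.app n) (hg₀ i n y ⟨i, hi⟩)).trans ?_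
    fin_cases i
    · exact (congrArg (fun k => k.app n y) h₀).symm
    · exact (congrArg (fun k => k.app n y) h₁).symm⟩
  have hl : ∀ (i : Fin 2) n (x : X.obj n), sq.lift.app n ((lift (𝟙 X) (constVertex X i)).app n x) =
      g₀.app n ⟨_, hmem i n x⟩ := fun i n x =>
    congrArg (fun f => f.app n ⟨_, hmem i n x⟩) sq.fac_left
  refine SHomotopy.of_tensor sq.lift ?_ ?_
  · ext n x
    exact (hl 0 n x).trans (hg₀ 0 n x _)
  · ext n x
    exact (hl 1 n x).trans (hg₀ 1 n x _)

lemma Htpy.of_comp_rlp {a b : X ⟶ E} (h : Htpy (a ≫ p) (b ≫ p)) : Htpy a b := by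
  obtain ⟨f, hf⟩ : ∃ f, a ≫ p = f := ⟨_, rfl⟩
  obtain ⟨g, hg⟩ : ∃ g, b ≫ p = g := ⟨_, rfl⟩
  rw [hf, hg] at h
  induction h generalizing a b with
  | rel f g h => exact (SHomotopy.of_comp_rlp hp (by rwa [hf, hg])).htpy
  | refl f => exact (SHomotopy.of_comp_rlp hp (by rw [hf, hg]; exact SHomotopy.refl _)).htpy
  | symm f g _ h => exact (h hg hf).symm
  | trans f g k _ _ h h' =>
    obtain ⟨c, hc⟩ := exists_lift_of_rlp hp g
    exact (h hf hc).trans (h' hc hg)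

end Homotopies

section WordComplex

/-- A monotone map from `P` to `[m]` sends simplices of the nerve of `P` to simplices of `Δ[m]`. -/
def simplexHom {P : Type w} [Preorder P] {m : SimplexCategory} (f : P →o Fin (m.len + 1))
    {n : SimplexCategoryᵒᵖ} (x : (nerve P).obj n) : n.unop ⟶ m :=
  SimplexCategory.Hom.mk ⟨fun i => f (x.obj i), fun _ _ h => f.monotone (x.monotone h)⟩

/-- The simplex of the nerve of `CappedWord m` made of the vertices. -/
def CappedWord.vertices (m : SimplexCategory) : (nerve (CappedWord.{w} m)).obj (.op m) :=
  Monotone.functor (f := CappedWord.vertex) fun _ _ h => h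

variable (K : SSet.{w})

/-- Evaluation at the simplex made of the vertices. -/
def cappedEval : cappedComplex K ⟶ K where
  app m := ↾fun q => q.app m (CappedWord.vertices m.unop)
  naturality m m' θ := by
    ext q
    exact congrArg (fun k => k (CappedWord.vertices m.unop)) (q.naturality θ)

/-- The degenerate families of simplices indexed by capped words. -/
noncomputable def toCappedComplex : K ⟶ cappedComplex K where
  app m := ↾fun x =>
    { app n := ↾fun q => K.map (simplexHom (CappedWord.last m.unop) q).op x
      naturality n n' θ := by
        ext q
        exact ConcreteCategory.congr_hom
          (K.map_comp (simplexHom (CappedWord.last m.unop) q).op θ) x }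
  naturality m m' θ := by
    ext x
    refine hom_ext_apply (X := nerve (CappedWord m'.unop)) (Y := K) fun n q => ?_
    refine (ConcreteCategory.congr_hom
      (K.map_comp θ (simplexHom (CappedWord.last m'.unop) q).op) x).symm.trans ?_
    change K.map _ x = K.map _ x
    refine congrArg (fun f => K.map f x) ?_
    apply Quiver.Hom.unop_inj
    ext i : 3
    exact (CappedWord.last_map θ.unop (q.obj i)).symm

lemma toCappedComplex_comp_cappedEval : toCappedComplex K ≫ cappedEval K = 𝟙 K := by
  ext m x
  exact ConcreteCategory.congr_hom (K.map_id m) x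

/-- The degenerate families of simplices indexed by tagged words. -/
noncomputable def toWordComplex : K ⟶ wordComplex K := toCappedComplex K ≫ cappedRestrict K

open scoped Classical in
/-- The interpolation between words and vertices. -/
noncomputable def CappedWord.cut {m : SimplexCategory} (t : m ⟶ ⦋1⦌) :
    TaggedWord.{w} m →o CappedWord.{w} m where
  toFun G := if t.toOrderHom (TaggedWord.last m G) = 0 then word G else vertex (TaggedWord.last m G)
  monotone' G G' h := by
    have hl := (TaggedWord.last m).monotone h
    dsimp only
    split_ifs with h₀ h₁ h₁
    · exact h
    · exact fun p hp => (TaggedWord.le_last hp).trans hl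
    · exact (h₀ (le_antisymm ((t.toOrderHom.monotone hl).trans h₁.le) (Fin.zero_le _))).elim
    · exact hl

open scoped Classical in
lemma CappedWord.cut_apply {m : SimplexCategory} (t : m ⟶ ⦋1⦌) (G : TaggedWord.{w} m) :
    cut t G = if t.toOrderHom (TaggedWord.last m G) = 0 then word G
      else vertex (TaggedWord.last m G) := rfl

lemma CappedWord.cut_const_zero {m : SimplexCategory} (G : TaggedWord.{w} m) :
    cut (SimplexCategory.const m ⦋1⦌ 0) G = word G := by
  rw [cut_apply]
  exact if_pos rfl

lemma CappedWord.cut_const_one {m : SimplexCategory} (G : TaggedWord.{w} m) :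
    cut (SimplexCategory.const m ⦋1⦌ 1) G = vertex (TaggedWord.last m G) := by
  rw [cut_apply]
  exact if_neg one_ne_zero

lemma shomotopy_cappedRestrict :
    SHomotopy (cappedRestrict K) (cappedEval K ≫ toWordComplex K) := by
  refine SHomotopy.of_family (fun m q t => nerveHom (CappedWord.cut t) ≫ q) ?_ ?_ ?_
  · intro l m θ q t
    refine Eq.trans ?_ (Category.assoc (nerveHom (CappedWord.cut (θ ≫ t))) (cappedNerve.map θ) q)
    refine (Category.assoc (wordNerve.map θ) (nerveHom (CappedWord.cut t)) q).symm.trans ?_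
    refine congrArg (· ≫ q) ?_
    refine hom_ext_apply fun n x => ?_
    refine nerve_ext (P := CappedWord m) fun i => ?_
    change CappedWord.cut t (TaggedWord.map θ (x.obj i)) =
      CappedWord.map θ (CappedWord.cut (θ ≫ t) (x.obj i))
    have h : (θ ≫ t).toOrderHom (TaggedWord.last l (x.obj i)) =
      t.toOrderHom (θ.toOrderHom (TaggedWord.last l (x.obj i))) := rfl
    simp only [CappedWord.cut_apply, TaggedWord.last_map, h]
    split_ifs <;> rfl
  · intro m q
    refine congrArg (· ≫ q) ?_
    refine hom_ext_apply fun n x => ?_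
    refine nerve_ext (P := CappedWord m) fun i => ?_
    exact CappedWord.cut_const_zero (x.obj i)
  · intro m q
    refine hom_ext_apply (X := nerve (TaggedWord m)) (Y := K) fun n x => ?_
    refine Eq.trans ?_ (ConcreteCategory.congr_hom
      (q.naturality (simplexHom (TaggedWord.last m) x).op) (CappedWord.vertices m))
    refine congrArg (fun z => q.app n z) ?_
    refine nerve_ext (P := CappedWord m) fun i => ?_
    exact CappedWord.cut_const_one (x.obj i)

variable {K} (hK : SSet.KanComplex K)

include hK

lemma exists_htpy_toWordComplex {X : SSet.{w}} (f : X ⟶ wordComplex K) :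
    ∃ h : X ⟶ K, Htpy (h ≫ toWordComplex K) f := by
  obtain ⟨g, rfl⟩ := exists_lift_of_rlp (rlp_cappedRestrict hK) f
  refine ⟨g ≫ cappedEval K, ?_⟩
  rw [Category.assoc]
  exact ((shomotopy_cappedRestrict K).precomp g).htpy.symm

lemma Htpy.of_comp_toWordComplex {X : SSet.{w}} {h h' : X ⟶ K}
    (H : Htpy (h ≫ toWordComplex K) (h' ≫ toWordComplex K)) : Htpy h h' := by
  have H : Htpy ((h ≫ toCappedComplex K) ≫ cappedRestrict K)
    ((h' ≫ toCappedComplex K) ≫ cappedRestrict K) := H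
  simpa [toCappedComplex_comp_cappedEval] using
    (Htpy.of_comp_rlp (rlp_cappedRestrict hK) H).postcomp (cappedEval K)

end WordComplex

section Chains

variable (B : Type u) [Category.{v} B]

/-- The functor induced by an inclusion of finite sets of natural numbers. -/
def inclFunctor {S S' : Finset ℕ} (h : S ⊆ S') : S ⥤ S' :=
  Monotone.functor (f := fun i => ⟨i.1, h i.2⟩) fun _ _ h => h

lemma functor_ext_of_obj {P Q : Type*} [Preorder P] [PartialOrder Q] {F G : P ⥤ Q}
    (h : ∀ x, F.obj x = G.obj x) : F = G :=
  CategoryTheory.Functor.ext h fun _ _ _ => Subsingleton.elim _ _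

variable {B} in
lemma map_eq_of_thin {P : Type*} [PartialOrder P] (y : P ⥤ B) {a b c a' c' : P} (p : a = b)
    (g : b ⟶ c) (q : a = a') (f : a' ⟶ c') (r : c' = c) :
    eqToHom (congrArg y.obj p) ≫ y.map g =
      eqToHom (congrArg y.obj q) ≫ y.map f ≫ eqToHom (congrArg y.obj r) := by
  subst p q r
  simp only [eqToHom_refl, Category.id_comp, Category.comp_id]
  exact congrArg y.map (Subsingleton.elim _ _)

/-- A functor to `B` from a nonempty finite set of natural numbers. -/
structure LabelledChain where
  letters : Finset ℕ
  nonempty : letters.Nonempty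
  diagram : letters ⥤ B

namespace LabelledChain

variable {B}

instance : PartialOrder (LabelledChain B) where
  le x y := ∃ h : x.letters ⊆ y.letters, inclFunctor h ⋙ y.diagram = x.diagram
  le_refl x := ⟨subset_rfl, rfl⟩
  le_trans x y z := by
    rintro ⟨h, e⟩ ⟨h', e'⟩
    refine ⟨h.trans h', ?_⟩
    rw [← e, ← e']
    rfl
  le_antisymm := by
    rintro ⟨S, hS, σ⟩ ⟨S', hS', σ'⟩ ⟨h, e⟩ ⟨h', e'⟩
    obtain rfl : S = S' := h.antisymm h'
    obtain rfl : σ' = σ := e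
    rfl

/-- The last letter. -/
def top (x : LabelledChain B) : x.letters := ⟨x.letters.max' x.nonempty, x.letters.max'_mem _⟩

lemma le_top (x : LabelledChain B) (i : x.letters) : i ≤ x.top := x.letters.le_max' _ i.2

/-- The comparison between the last objects of two labelled chains. -/
def lastHom {x y : LabelledChain B} (h : x.letters ⊆ y.letters)
    (e : inclFunctor h ⋙ y.diagram = x.diagram) :
    x.diagram.obj x.top ⟶ y.diagram.obj y.top :=
  eqToHom (congrArg (fun F => F.obj x.top) e.symm) ≫
    y.diagram.map (homOfLE (y.le_top ⟨x.top.1, h x.top.2⟩))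

lemma lastHom_eq {x y : LabelledChain B} (h : x.letters ⊆ y.letters)
    (e : inclFunctor h ⋙ y.diagram = x.diagram)
    (p : x.diagram.obj x.top = y.diagram.obj ⟨x.top.1, h x.top.2⟩)
    (q : (⟨x.top.1, h x.top.2⟩ : y.letters) ≤ y.top) :
    lastHom h e = eqToHom p ≫ y.diagram.map (homOfLE q) := rfl

lemma lastHom_comp {S S' S'' : Finset ℕ} {hS : S.Nonempty} {hS' : S'.Nonempty}
    {hS'' : S''.Nonempty} {σ : S ⥤ B} {σ' : S' ⥤ B} {σ'' : S'' ⥤ B} (h : S ⊆ S')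
    (e : inclFunctor h ⋙ σ' = σ) (h' : S' ⊆ S'') (e' : inclFunctor h' ⋙ σ'' = σ')
    (h'' : S ⊆ S'') (e'' : inclFunctor h'' ⋙ σ'' = σ) :
    lastHom (x := ⟨S, hS, σ⟩) (y := ⟨S'', hS'', σ''⟩) h'' e'' =
      lastHom (x := ⟨S, hS, σ⟩) (y := ⟨S', hS', σ'⟩) h e ≫
        lastHom (x := ⟨S', hS', σ'⟩) (y := ⟨S'', hS'', σ''⟩) h' e' := by
  subst e' e
  exact (Category.id_comp _).trans ((σ''.map_comp (homOfLE _) (homOfLE _)).trans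
    (congrArg₂ (· ≫ ·) (Category.id_comp _).symm (Category.id_comp _).symm))

variable (B) in
/-- The last object of a labelled chain. -/
def last : LabelledChain B ⥤ B where
  obj x := x.diagram.obj x.top
  map f := lastHom (leOfHom f).1 (leOfHom f).2
  map_id x := by
    rw [lastHom_eq _ _ rfl le_rfl, eqToHom_refl, Category.id_comp]
    exact x.diagram.map_id _
  map_comp f g := lastHom_comp (leOfHom f).1 (leOfHom f).2 (leOfHom g).1 (leOfHom g).2 _ _

/-- The labelled chains of the image of a functor. -/
def map {A : Type u} [Category.{v} A] (ι : A ⥤ B) : LabelledChain A →o LabelledChain B where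
  toFun x := ⟨x.letters, x.nonempty, x.diagram ⋙ ι⟩
  monotone' x y := by
    rintro ⟨h, e⟩
    refine ⟨h, ?_⟩
    dsimp only
    rw [← e]
    rfl

lemma lastHom_map {A : Type u} [Category.{v} A] (ι : A ⥤ B) {S S' : Finset ℕ} {hS : S.Nonempty}
    {hS' : S'.Nonempty} {σ : S ⥤ A} {σ' : S' ⥤ A} (h : S ⊆ S') (e : inclFunctor h ⋙ σ' = σ)
    (e' : inclFunctor h ⋙ σ' ⋙ ι = σ ⋙ ι) :
    lastHom (x := ⟨S, hS, σ ⋙ ι⟩) (y := ⟨S', hS', σ' ⋙ ι⟩) h e' =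
      ι.map (lastHom (x := ⟨S, hS, σ⟩) (y := ⟨S', hS', σ'⟩) h e) := by
  subst e
  exact (Category.id_comp _).trans (congrArg ι.map (Category.id_comp _).symm)

lemma last_map {A : Type u} [Category.{v} A] (ι : A ⥤ B) {x y : LabelledChain A} (f : x ⟶ y)
    (f' : map ι x ⟶ map ι y) :
    (last B).map f' = ι.map ((last A).map f) :=
  lastHom_map ι (leOfHom f).1 (leOfHom f).2 (leOfHom f').2

end LabelledChain

namespace TaggedWord

variable {B} {m : SimplexCategory}

/-- The letters of a tagged word. -/
def letters (G : TaggedWord.{w} m) : Finset ℕ := G.graph.image Prod.fst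

lemma exists_tag (G : TaggedWord.{w} m) (l : G.letters) : ∃ i, (l.1, i) ∈ G.graph := by
  obtain ⟨p, hp, h⟩ := Finset.mem_image.1 l.2
  exact ⟨p.2, h ▸ hp⟩

/-- The tag of a letter. -/
noncomputable def tag (G : TaggedWord.{w} m) : G.letters →o Fin (m.len + 1) where
  toFun l := (G.exists_tag l).choose
  monotone' l l' h := G.mono _ (G.exists_tag l).choose_spec _ (G.exists_tag l').choose_spec h

lemma tag_mem (G : TaggedWord.{w} m) (l : G.letters) : (l.1, G.tag l) ∈ G.graph :=
  (G.exists_tag l).choose_spec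

lemma eq_tag {G : TaggedWord.{w} m} {l : G.letters} {i : Fin (m.len + 1)}
    (h : (l.1, i) ∈ G.graph) : i = G.tag l :=
  le_antisymm (G.mono _ h _ (G.tag_mem l) le_rfl) (G.mono _ (G.tag_mem l) _ h le_rfl)

/-- The labelled chain attached to a tagged word and a chain of morphisms. -/
noncomputable def chain (y : Fin (m.len + 1) ⥤ B) : TaggedWord.{w} m →o LabelledChain B where
  toFun G := ⟨G.letters, G.nonempty.image _, G.tag.monotone.functor ⋙ y⟩
  monotone' G G' h := by
    refine ⟨Finset.image_subset_image h, ?_⟩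
    dsimp only
    rw [← Functor.assoc]
    refine congrArg (· ⋙ y) (functor_ext_of_obj fun l => ?_)
    exact (eq_tag (l := ⟨l.1, Finset.image_subset_image h l.2⟩) (h (G.tag_mem l))).symm

lemma chain_map {l : SimplexCategory} (θ : l ⟶ m) (y : Fin (m.len + 1) ⥤ B)
    (G : TaggedWord.{w} l) :
    chain y (map θ G) = chain (θ.toOrderHom.monotone.functor ⋙ y) G := by
  have hl : (map θ G).letters = G.letters := by
    simp only [letters, graph_map, Finset.image_image]
    rfl
  have ht : ∀ (i : ℕ) (hi : i ∈ (map θ G).letters) (hi' : i ∈ G.letters),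
      (map θ G).tag ⟨i, hi⟩ = θ.toOrderHom (G.tag ⟨i, hi'⟩) := fun i hi hi' =>
    (eq_tag (G := map θ G) (Finset.mem_image.2 ⟨_, G.tag_mem ⟨i, hi'⟩, rfl⟩)).symm
  refine le_antisymm (Exists.intro hl.subset ?_) (Exists.intro hl.superset ?_)
  · refine congrArg (· ⋙ y) (functor_ext_of_obj (F := inclFunctor hl.subset ⋙
      G.tag.monotone.functor ⋙ θ.toOrderHom.monotone.functor)
      (G := (map θ G).tag.monotone.functor) fun i => ?_)
    exact (ht _ _ _).symm
  · refine congrArg (· ⋙ y) (functor_ext_of_obj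
      (F := inclFunctor hl.superset ⋙ (map θ G).tag.monotone.functor)
      (G := G.tag.monotone.functor ⋙ θ.toOrderHom.monotone.functor) fun i => ?_)
    exact ht _ _ _

lemma tag_top (y : Fin (m.len + 1) ⥤ B) (G : TaggedWord.{w} m) :
    G.tag (chain y G).top = last m G := by
  refine le_antisymm (le_last (G.tag_mem _)) (Finset.sup_le fun p hp => ?_)
  have hm : p.1 ∈ G.letters := Finset.mem_image_of_mem _ hp
  rw [eq_tag (l := ⟨p.1, hm⟩) hp]
  exact G.tag.monotone ((chain y G).le_top ⟨p.1, hm⟩)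

lemma chain_functor_comp_last (y : Fin (m.len + 1) ⥤ B) :
    (chain.{w} y).monotone.functor ⋙ LabelledChain.last B = (last m).monotone.functor ⋙ y := by
  refine CategoryTheory.Functor.ext (fun G => congrArg y.obj (tag_top y G)) fun G G' f => ?_
  have h := (chain.{w} y).monotone (leOfHom f)
  have e : G.tag (chain y G).top = G'.tag ⟨(chain y G).top.1, h.1 (chain y G).top.2⟩ :=
    eq_tag (leOfHom f (G.tag_mem _))
  change LabelledChain.lastHom h.1 h.2 = _
  rw [LabelledChain.lastHom_eq _ _ (congrArg y.obj e)
    ((chain y G').le_top ⟨(chain y G).top.1, h.1 (chain y G).top.2⟩)]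
  exact map_eq_of_thin y e (homOfLE _) (tag_top y G) _ (tag_top y G').symm

end TaggedWord

end Chains

section ChainRestrict

open MonoidalCategory CartesianMonoidalCategory

variable {A : Type u} [Category.{v} A] {B : Type u} [Category.{v} B]

/-- The map on nerves induced by a functor out of a preorder. -/
def nerveFunctor {P : Type (max u v)} [Preorder P] (F : P ⥤ B) : nerve P ⟶ nerve B where
  app _ := ↾fun G => G ⋙ F
  naturality _ _ _ := rfl

lemma nerveFunctor_shomotopy {P : Type (max u v)} [Preorder P] {F F' : P ⥤ B} (α : F ⟶ F') :
    SHomotopy (nerveFunctor F) (nerveFunctor F') := by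
  refine SHomotopy.of_family (fun m x t => (t.toOrderHom.monotone.functor).prod' x ⋙
    Functor.uncurry.obj (ComposableArrows.mk₁ α)) ?_ ?_ ?_
  · intro l m θ x t
    rfl
  · intro m x
    refine CategoryTheory.Functor.ext (fun i => rfl) fun i j f => ?_
    exact (Category.id_comp _).trans ((Category.id_comp _).trans (Category.comp_id _)).symm
  · intro m x
    refine CategoryTheory.Functor.ext (fun i => rfl) fun i j f => ?_
    exact (Category.id_comp _).trans ((Category.id_comp _).trans (Category.comp_id _)).symm

variable {K : SSet.{max u v}}

/-- A map from the nerve of the poset of labelled chains induces families of simplices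
indexed by tagged words. -/
noncomputable def chainRestrict (g : nerve (LabelledChain B) ⟶ K) : nerve B ⟶ wordComplex K where
  app m := ↾fun y => nerveHom (TaggedWord.chain (m := m.unop) y) ≫ g
  naturality m m' θ := by
    ext y
    refine Eq.trans ?_ (Category.assoc (wordNerve.map θ.unop)
      (nerveHom (TaggedWord.chain (m := m.unop) y)) g)
    refine congrArg (· ≫ g) ?_
    refine hom_ext_apply fun n x => ?_
    refine nerve_ext (P := LabelledChain B) fun i => ?_
    exact (TaggedWord.chain_map θ.unop y (x.obj i)).symm

/-- The map to `Δ[1]` induced by a simplex of `Δ[1]`. -/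
noncomputable def wordCut {m : SimplexCategory} (t : m ⟶ ⦋1⦌) :
    nerve (TaggedWord.{w} m) ⟶ Δ[1] where
  app _ := ↾fun x => ULift.up (simplexHom (TaggedWord.last m) x ≫ t)
  naturality _ _ _ := rfl

lemma chainRestrict_shomotopy {g g' : nerve (LabelledChain B) ⟶ K} (h : SHomotopy g g') :
    SHomotopy (chainRestrict g) (chainRestrict g') := by
  obtain ⟨H, rfl, rfl⟩ := h.exists_tensor
  refine SHomotopy.of_family
    (fun m y t => lift (nerveHom (TaggedWord.chain y)) (wordCut t) ≫ H) ?_ ?_ ?_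
  · intro l m θ y t
    refine Eq.trans (Category.assoc (wordNerve.map θ)
      (lift (nerveHom (TaggedWord.chain y)) (wordCut t)) H).symm ?_
    refine congrArg (· ≫ H) ?_
    refine hom_ext_apply fun n x => Prod.ext ?_ ?_
    · refine nerve_ext (P := LabelledChain B) fun i => ?_
      exact TaggedWord.chain_map θ y (x.obj i)
    · refine congrArg ULift.up (SimplexCategory.Hom.ext _ _ (OrderHom.ext _ _ (funext fun i => ?_)))
      exact congrArg t.toOrderHom (TaggedWord.last_map θ (x.obj i))
  · intro m y
    exact hom_ext_apply (X := nerve (TaggedWord m)) (Y := K) fun n x => rfl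
  · intro m y
    exact hom_ext_apply (X := nerve (TaggedWord m)) (Y := K) fun n x => rfl

lemma chainRestrict_htpy {g g' : nerve (LabelledChain B) ⟶ K} (h : Htpy g g') :
    Htpy (chainRestrict g) (chainRestrict g') :=
  h.map chainRestrict fun _ _ => chainRestrict_shomotopy

lemma comp_toWordComplex (h : nerve B ⟶ K) :
    h ≫ toWordComplex K = chainRestrict (nerveFunctor (LabelledChain.last B) ≫ h) := by
  refine hom_ext_apply fun m y => ?_
  refine hom_ext_apply (X := nerve (TaggedWord m.unop)) (Y := K) fun n x => ?_
  refine (ConcreteCategory.congr_hom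
    (h.naturality (simplexHom (TaggedWord.last m.unop) x).op) y).symm.trans ?_
  refine congrArg (fun z => h.app n z) ?_
  exact (congrArg (x ⋙ ·) (TaggedWord.chain_functor_comp_last y)).symm

lemma nerveMap_comp_chainRestrict (ι : A ⥤ B) (g : nerve (LabelledChain B) ⟶ K) :
    nerveMap ι ≫ chainRestrict g = chainRestrict (nerveHom (LabelledChain.map ι) ≫ g) := rfl

/-- A full subcategory inclusion induces a weak homotopy equivalence of nerves as soon as
diagrams indexed by chains can be compared with diagrams in the subcategory. -/
theorem isWeakHomotopyEquiv_of_chains (ι : A ⥤ B) [ι.Full] [ι.Faithful]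
    (R : LabelledChain B ⥤ A) (α : LabelledChain.last B ⟶ R ⋙ ι) :
    IsWeakHomotopyEquiv (nerveMap ι) := by
  intro K hK
  constructor
  · intro g
    obtain ⟨h, hh⟩ := exists_htpy_toWordComplex hK (chainRestrict (nerveFunctor R ≫ g))
    refine ⟨h, Htpy.of_comp_toWordComplex hK ?_⟩
    rw [Category.assoc]
    refine (hh.precomp (nerveMap ι)).trans ?_
    rw [nerveMap_comp_chainRestrict, comp_toWordComplex]
    refine chainRestrict_htpy ?_
    let β : LabelledChain.last A ⟶ (LabelledChain.map ι).monotone.functor ⋙ R :=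
      { app x := ι.preimage (α.app (LabelledChain.map ι x))
        naturality x y f := by
          apply ι.map_injective
          refine (ι.map_comp _ _).trans (Eq.trans ?_ (ι.map_comp _ _).symm)
          refine (congrArg (_ ≫ ·) (ι.map_preimage _)).trans
            (Eq.trans ?_ (congrArg (· ≫ _) (ι.map_preimage _).symm))
          refine Eq.trans ?_ (α.naturality ((LabelledChain.map ι).monotone.functor.map f))
          exact congrArg (· ≫ _) (LabelledChain.last_map ι f _).symm }
    exact ((nerveFunctor_shomotopy β).postcomp g).htpy.symm
  · intro h h' H
    refine Htpy.of_comp_toWordComplex hK ?_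
    have key (k : nerve B ⟶ K) : Htpy (k ≫ toWordComplex K)
        (chainRestrict (nerveFunctor R ≫ nerveMap ι ≫ k)) := by
      rw [comp_toWordComplex]
      exact chainRestrict_htpy ((nerveFunctor_shomotopy α).postcomp k).htpy
    exact ((key h).trans (chainRestrict_htpy (H.precomp (nerveFunctor R)))).trans (key h').symm

end ChainRestrict

section Replacement

namespace ModelStructure

variable {D : Type u} [Category.{v} D] (M : ModelStructure D)

lemma W_of_llp {X Y : D} {f : X ⟶ Y} (hf : M.Fib.llp f) : M.W f := by
  obtain ⟨Z, i, p, -, hi, hp, rfl⟩ := M.fact_acof_fib f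
  have := hf p hp
  have sq : CommSq i (i ≫ p) p (𝟙 Y) := ⟨by simp⟩
  exact M.W_retract ⟨𝟙 X, 𝟙 X, sq.lift, p, by simp, by simp, by simp, by simp⟩ hi

lemma fibrant_of_retract [HasTerminal D] {X Y : D} (i : X ⟶ Y) (r : Y ⟶ X) (h : i ≫ r = 𝟙 X)
    (hY : Fibrant M Y) : Fibrant M X :=
  M.Fib_retract ⟨i, r, 𝟙 _, 𝟙 _, h, by simp, by simp, by simp⟩ hY

lemma exists_fibrant [HasTerminal D] (X : D) :
    ∃ (Z : D) (i : X ⟶ Z), M.Fib.llp i ∧ Fibrant M Z := by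
  obtain ⟨Z, i, p, hi, hi', hp, -⟩ := M.fact_acof_fib (terminal.from X)
  refine ⟨Z, i, fun _ _ q hq => M.lifting_acof_fib i q hi hi' hq, ?_⟩
  obtain rfl : p = terminal.from Z := Subsingleton.elim _ _
  exact hp

end ModelStructure

variable {P : Type*} [Category* P] {D : Type u} [Category.{v} D]
  (S : Set P) [∀ k, HasColimitsOfShape (Discrete (Σ j : S, (j.1 ⟶ k))) D]

/-- The diagram freely generated by objects indexed by `S`. -/
noncomputable def freeDiagram (Y : S → D) : P ⥤ D where
  obj k := ∐ fun s : Σ j : S, (j.1 ⟶ k) => Y s.1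
  map g := Sigma.desc fun s => Sigma.ι (fun s : Σ j : S, (j.1 ⟶ _) => Y s.1) ⟨s.1, s.2 ≫ g⟩
  map_id k := by
    refine Sigma.hom_ext _ _ fun s => ?_
    rw [Sigma.ι_desc, Category.comp_id, Category.comp_id]
  map_comp f g := by
    refine Sigma.hom_ext _ _ fun s => ?_
    rw [Sigma.ι_desc, Sigma.ι_desc_assoc, Sigma.ι_desc, Category.assoc]

/-- Functoriality of the free diagram. -/
noncomputable def freeDiagramMap {Y Z : S → D} (i : ∀ j, Y j ⟶ Z j) :
    freeDiagram S Y ⟶ freeDiagram S Z where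
  app k := Limits.Sigma.map fun s : Σ j : S, (j.1 ⟶ k) => i s.1
  naturality k l g := by
    refine Sigma.hom_ext _ _ fun s => ?_
    simp [freeDiagram]

/-- The counit of the adjunction between free and underlying diagrams. -/
noncomputable def freeDiagramCounit (X : P ⥤ D) : freeDiagram S (fun j => X.obj j) ⟶ X where
  app k := Sigma.desc fun s => X.map s.2
  naturality k l g := by
    refine Sigma.hom_ext _ _ fun s => ?_
    simp [freeDiagram]

lemma freeDiagramMap_llp {Y Z : S → D} (i : ∀ j, Y j ⟶ Z j) (F : MorphismProperty D)
    (hi : ∀ j, F.llp (i j)) (k : P) : F.llp ((freeDiagramMap S i).app k) := by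
  intro _ _ q hq
  have := fun j => hi j q hq
  exact inferInstanceAs
    (HasLiftingProperty (Limits.Sigma.map fun s : Σ j : S, (j.1 ⟶ k) => i s.1) q)

variable {S}

lemma isIso_freeDiagramCounit (X : P ⥤ D) (k : P) [Unique (Σ j : S, (j.1 ⟶ k))]
    (h : IsIso (default : Σ j : S, (j.1 ⟶ k)).2) : IsIso ((freeDiagramCounit S X).app k) := by
  have e : (freeDiagramCounit S X).app k =
      (coproductUniqueIso fun s : Σ j : S, (j.1 ⟶ k) => X.obj s.1).hom ≫
        X.map (default : Σ j : S, (j.1 ⟶ k)).2 := by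
    refine ((coproductUniqueIso fun s : Σ j : S, (j.1 ⟶ k) => X.obj s.1).inv_comp_eq).1 ?_
    rw [coproductUniqueIso_inv]
    exact Sigma.ι_desc _ _
  rw [e]
  exact ((coproductUniqueIso fun s : Σ j : S, (j.1 ⟶ k) => X.obj s.1) ≪≫
    asIso (X.map (default : Σ j : S, (j.1 ⟶ k)).2)).isIso_hom

variable (M : ModelStructure D) [HasFiniteLimits D] [HasFiniteColimits D]

omit [∀ k, HasColimitsOfShape (Discrete (Σ j : S, (j.1 ⟶ k))) D] in
/-- One step of the fibrant replacement of a diagram. -/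
lemma exists_fibrant_step (hfin : ∀ k : P, Finite (Σ j : S, (j.1 ⟶ k)))
    (hS : ∀ (k : S) (s : Σ j : S, (j.1 ⟶ k.1)), s = ⟨k, 𝟙 k.1⟩) (X : P ⥤ D) :
    ∃ (X' : P ⥤ D) (α : X ⟶ X'), (∀ k, M.W (α.app k)) ∧ ∀ k : S, Fibrant M (X'.obj k) := by
  have (k : P) : HasColimitsOfShape (Discrete (Σ j : S, (j.1 ⟶ k))) D :=
    hasColimitsOfShape_discrete _ _
  choose Z i hi hZ using fun j : S => M.exists_fibrant (X.obj j)
  let ε := freeDiagramCounit S X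
  let p := freeDiagramMap S i
  have sq (k : P) : IsPushout (ε.app k) (p.app k) ((pushout.inl ε p).app k)
      ((pushout.inr ε p).app k) :=
    (IsPushout.of_hasPushout ε p).map ((evaluation P D).obj k)
  refine ⟨pushout ε p, pushout.inl ε p, fun k => M.W_of_llp ?_, fun k => ?_⟩
  · exact MorphismProperty.of_isPushout (sq k) (freeDiagramMap_llp S i _ hi k)
  · let : Unique (Σ j : S, (j.1 ⟶ k.1)) := ⟨⟨⟨k, 𝟙 k.1⟩⟩, hS k⟩
    have : IsIso (ε.app k) := isIso_freeDiagramCounit X k.1 (inferInstanceAs (IsIso (𝟙 k.1)))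
    have : IsIso ((pushout.inr ε p).app k.1) := (sq k.1).isIso_inr_of_isIso
    let e' := asIso ((pushout.inr ε p).app k.1)
    let e := (coproductUniqueIso fun s : Σ j : S, (j.1 ⟶ k.1) => Z s.1).symm ≪≫ e'
    exact M.fibrant_of_retract e.inv e.hom e.inv_hom_id (hZ k)

/-- Fibrant replacement of diagrams indexed by a direct category. -/
theorem exists_fibrant_diagram (rk : P → ℕ) (hfin : ∀ k : P, Finite (Σ j, (j ⟶ k)))
    (hrk : ∀ {j k : P} (_ : j ⟶ k), rk j ≤ rk k)
    (hP : ∀ (k : P) (s : Σ j, (j ⟶ k)), rk s.1 = rk k → s = ⟨k, 𝟙 k⟩) (X : P ⥤ D) :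
    ∃ (R : P ⥤ D) (α : X ⟶ R), (∀ k, M.W (α.app k)) ∧ ∀ k, Fibrant M (R.obj k) := by
  have step (n : ℕ) (X : P ⥤ D) := exists_fibrant_step (S := {j | rk j = n}) M
    (fun k => Finite.of_injective (fun s => (⟨s.1.1, s.2⟩ : Σ j, (j ⟶ k))) (by
      rintro ⟨⟨j, hj⟩, f⟩ ⟨⟨j', hj'⟩, f'⟩ h
      cases h
      rfl)) (by
      rintro ⟨k, rfl⟩ ⟨⟨j, hj⟩, f⟩
      cases hP k ⟨j, f⟩ hj
      rfl) X
  choose Y a ha hY using step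
  let s (n : ℕ) : P ⥤ D := n.rec X Y
  let t (n : ℕ) : s n ⟶ s (n + 1) := a n (s n)
  let T : ℕ ⥤ P ⥤ D := Functor.ofSequence t
  have hT {i j : ℕ} (h : i ⟶ j) (k : P) : M.W ((T.map h).app k) := by
    obtain ⟨d, rfl⟩ := Nat.exists_eq_add_of_le (leOfHom h)
    induction d with
    | zero =>
      obtain rfl : h = 𝟙 i := Subsingleton.elim _ _
      rw [T.map_id]
      exact M.W_id _
    | succ d ih =>
      have e : h = homOfLE (Nat.le_add_right i d) ≫ homOfLE (Nat.le_succ (i + d)) :=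
        Subsingleton.elim _ _
      rw [e, T.map_comp]
      refine M.W_comp _ _ (ih _) ?_
      rw [Functor.ofSequence_map_homOfLE_succ]
      exact ha _ _ _
  let r : P ⥤ ℕ :=
    { obj k := rk k + 1
      map f := homOfLE (Nat.succ_le_succ (hrk f)) }
  refine ⟨r.prod' (𝟭 P) ⋙ Functor.uncurry.obj T,
    { app k := (T.map (homOfLE (Nat.zero_le (rk k + 1)))).app k
      naturality j k f := ?_ }, fun k => hT _ _, fun k => hY (rk k) (s (rk k)) ⟨k, rfl⟩⟩
  have e : homOfLE (Nat.zero_le (rk k + 1)) = homOfLE (Nat.zero_le (rk j + 1)) ≫ r.map f :=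
    Subsingleton.elim _ _
  rw [e, T.map_comp]
  refine (congrArg (X.map f ≫ ·) (NatTrans.comp_app _ _ _)).trans ?_
  refine (Category.assoc _ _ _).symm.trans ?_
  refine (congrArg (· ≫ _) ((T.map (homOfLE (Nat.zero_le (rk j + 1)))).naturality f)).trans ?_
  refine (Category.assoc _ _ _).trans ?_
  exact congrArg (_ ≫ ·) ((T.map (r.map f)).naturality f)

end Replacement

section ChainReplacement

instance {B : Type u} [Category.{v} B] (y : LabelledChain B) : Finite (Set.Iic y) := by
  refine Finite.of_injective
    (fun x : Set.Iic y => (⟨x.1.letters, Finset.mem_powerset.2 x.2.1⟩ : y.letters.powerset)) ?_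
  rintro ⟨⟨S, hS, σ⟩, h, e⟩ ⟨⟨S', hS', σ'⟩, h', e'⟩ he
  obtain rfl : S = S' := congrArg Subtype.val he
  obtain rfl : σ = σ' := e.symm.trans e'
  rfl

lemma LabelledChain.eq_of_card {B : Type u} [Category.{v} B] {x y : LabelledChain B} (h : x ≤ y)
    (hc : y.letters.card ≤ x.letters.card) : x = y := by
  obtain ⟨S, hS, σ⟩ := x
  obtain ⟨S', hS', σ'⟩ := y
  obtain ⟨h, e⟩ := h
  obtain rfl : S = S' := Finset.eq_of_subset_of_card_le h hc
  obtain rfl : σ' = σ := e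
  rfl

variable {D : Type u} [Category.{v} D] [HasFiniteLimits D] [HasFiniteColimits D]
  (M : ModelStructure D) {B : Type*} [Category* B] {E : Type} [SmallCategory E] [Finite E]
  [Quiver.IsThin E] (rk : E → ℕ) (hrk : ∀ {j k : E} (_ : j ⟶ k), rk j ≤ rk k)
  (hE : ∀ {j k : E} (_ : j ⟶ k), rk j = rk k → j = k)

include hrk hE in
/-- Fibrant replacement of diagrams indexed by labelled chains. -/
lemma exists_fibrant_chainDiagram (L : LabelledChain B ⥤ E ⥤ D)
    (hL : ∀ {x y} (f : x ⟶ y) k, M.W ((L.map f).app k)) :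
    ∃ (R : LabelledChain B ⥤ E ⥤ D) (α : L ⟶ R), (∀ x k, M.W ((α.app x).app k)) ∧
      (∀ {x y} (f : x ⟶ y) k, M.W ((R.map f).app k)) ∧ ∀ x k, Fibrant M ((R.obj x).obj k) := by
  obtain ⟨R, α, hα, hR⟩ := exists_fibrant_diagram M
    (fun p : LabelledChain B × E => p.1.letters.card + rk p.2) (fun p =>
      Finite.of_injective (fun s : Σ j, (j ⟶ p) => ((⟨s.1.1, leOfHom s.2.1⟩, s.1.2) :
        Set.Iic p.1 × E)) (by
        rintro ⟨⟨x, j⟩, f, g⟩ ⟨⟨x', j'⟩, f', g'⟩ h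
        obtain ⟨h₁, h₂⟩ := Prod.ext_iff.1 h
        obtain rfl : x = x' := congrArg Subtype.val h₁
        obtain rfl : j = j' := h₂
        obtain rfl : f = f' := Subsingleton.elim _ _
        obtain rfl : g = g' := Subsingleton.elim _ _
        rfl))
    (fun f => add_le_add (Finset.card_le_card (leOfHom f.1).1) (hrk f.2)) (by
      rintro ⟨y, k⟩ ⟨⟨x, j⟩, f, g⟩ h
      have h₁ : x.letters.card ≤ y.letters.card := Finset.card_le_card (leOfHom f).1
      have h₂ := hrk g
      dsimp only at h h₂
      obtain rfl : x = y := LabelledChain.eq_of_card (leOfHom f) (by omega)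
      obtain rfl : j = k := hE g (by omega)
      obtain rfl : f = 𝟙 x := Subsingleton.elim _ _
      obtain rfl : g = 𝟙 j := Subsingleton.elim _ _
      rfl) (Functor.uncurry.obj L)
  let β : L ⟶ Functor.curry.obj R :=
    { app x :=
        { app k := α.app (x, k)
          naturality j k g := by
            have h := α.naturality (X := (x, j)) (Y := (x, k)) (𝟙 x, g)
            refine Eq.trans (congrArg (· ≫ _) ?_) h
            exact (congrArg (· ≫ (L.obj x).map g) (congrArg (fun a => NatTrans.app a j)
              (L.map_id x))).trans (Category.id_comp _) |>.symm }
      naturality x y f := by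
        ext k
        have h := α.naturality (X := (x, k)) (Y := (y, k)) (f, 𝟙 k)
        refine Eq.trans (congrArg (· ≫ _) ?_) h
        exact ((congrArg ((L.map f).app k ≫ ·) ((L.obj y).map_id k)).trans
          (Category.comp_id _)).symm }
  refine ⟨Functor.curry.obj R, β, fun x k => hα _, fun {x y} f k => ?_, fun x k => hR _⟩
  refine M.W_of_precomp ((β.app x).app k) _ (hα _) ?_
  rw [← NatTrans.comp_app, ← β.naturality, NatTrans.comp_app]
  exact M.W_comp _ _ (hL f k) (hα _)

end ChainReplacement

section Fibrant

/-- The underlying diagram functor. -/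
def FunW.forget (n : ℕ) (R : Type u) [Category.{v} R] (ρ : RelCatStruct R) :
    FunW n R ρ ⥤ Fin (n + 1) ⥤ R where
  obj A := A.F
  map η := η.1

variable {D : Type u} [Category.{v} D] [HasFiniteLimits D] [HasFiniteColimits D]
  (M : ModelStructure D) (n : ℕ)

lemma isWeakHomotopyEquiv_fibrant : IsWeakHomotopyEquiv (nerveMap (ObjectProperty.ι
    (fun A : FunW n D M.relcat => ∀ k, Fibrant M (A.F.obj k)))) := by
  obtain ⟨R, α, hα, hR, hR'⟩ := exists_fibrant_chainDiagram M (E := Fin (n + 1)) Fin.val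
    (fun f => leOfHom f) (fun _ h => Fin.ext h)
    (LabelledChain.last (FunW n D M.relcat) ⋙ FunW.forget n D M.relcat) (fun {x y} f k =>
      ((LabelledChain.last (FunW n D M.relcat)).map f).2 k)
  let R' : LabelledChain (FunW n D M.relcat) ⥤ FunW n D M.relcat :=
    { obj x := ⟨R.obj x⟩
      map f := ⟨R.map f, hR f⟩
      map_id x := Subtype.ext (R.map_id x)
      map_comp f g := Subtype.ext (R.map_comp f g) }
  exact isWeakHomotopyEquiv_of_chains _
    (ObjectProperty.lift (fun A : FunW n D M.relcat => ∀ k, Fibrant M (A.F.obj k)) R' hR')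
    { app x := ⟨α.app x, hα x⟩
      naturality x y f := Subtype.ext (α.naturality f) }

end Fibrant

section Opposite

variable {C : Type u} [Category.{v} C] (M : ModelStructure C)

lemma IsRetractOf.unop {X Y X' Y' : Cᵒᵖ} {f : X ⟶ Y} {g : X' ⟶ Y'} (h : IsRetractOf f g) :
    IsRetractOf f.unop g.unop := by
  obtain ⟨i, r, j, s, h₁, h₂, h₃, h₄⟩ := h
  exact ⟨s.unop, j.unop, r.unop, i.unop, congrArg Quiver.Hom.unop h₂,
    congrArg Quiver.Hom.unop h₁, congrArg Quiver.Hom.unop h₄.symm,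
    congrArg Quiver.Hom.unop h₃.symm⟩

/-- The opposite model structure. -/
def ModelStructure.op : ModelStructure Cᵒᵖ where
  W := M.W.op
  Cof := M.Fib.op
  Fib := M.Cof.op
  W_id X := M.W_id _
  Cof_id X := M.Fib_id _
  Fib_id X := M.Cof_id _
  W_comp f g hf hg := M.W_comp _ _ hg hf
  Cof_comp f g hf hg := M.Fib_comp _ _ hg hf
  Fib_comp f g hf hg := M.Cof_comp _ _ hg hf
  W_of_precomp f g hf h := M.W_of_postcomp g.unop f.unop hf h
  W_of_postcomp f g hg h := M.W_of_precomp g.unop f.unop hg h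
  W_retract h := M.W_retract h.unop
  Cof_retract h := M.Fib_retract h.unop
  Fib_retract h := M.Cof_retract h.unop
  lifting_acof_fib i p hi hi' hp :=
    (HasLiftingProperty.iff_unop i p).2 (M.lifting_cof_afib p.unop i.unop hp hi hi')
  lifting_cof_afib i p hi hp hp' :=
    (HasLiftingProperty.iff_unop i p).2 (M.lifting_acof_fib p.unop i.unop hp hp' hi)
  fact_acof_fib f := by
    obtain ⟨Z, i, p, hi, hp, hp', e⟩ := M.fact_cof_afib f.unop
    exact ⟨.op Z, p.op, i.op, hp, hp', hi, congrArg Quiver.Hom.op e⟩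
  fact_cof_afib f := by
    obtain ⟨Z, i, p, hi, hi', hp, e⟩ := M.fact_acof_fib f.unop
    exact ⟨.op Z, p.op, i.op, hp, hi, hi', congrArg Quiver.Hom.op e⟩

lemma ModelStructure.cofibrant_of_fibrant_op [HasInitial C] {X : Cᵒᵖ}
    (h : Fibrant M.op X) : Cofibrant M X.unop := by
  have h' : M.Cof (terminal.from X).unop := h
  refine M.Cof_retract ⟨initial.to _, (terminal.from (Opposite.op (⊥_ C))).unop, 𝟙 _, 𝟙 _,
    Subsingleton.elim _ _, Category.comp_id _, Subsingleton.elim _ _, ?_⟩ h'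
  rw [Category.comp_id]
  exact congrArg Quiver.Hom.unop (Subsingleton.elim
    ((initial.to X.unop).op ≫ terminal.from (Opposite.op (⊥_ C))) (terminal.from X))

variable [HasFiniteLimits C] [HasFiniteColimits C] (n : ℕ)

lemma isWeakHomotopyEquiv_op_cofibrant : IsWeakHomotopyEquiv (nerveMap (Functor.op
    (ObjectProperty.ι (fun A : FunW n C M.relcat => ∀ k, Cofibrant M (A.F.obj k))))) := by
  let Q : ObjectProperty (FunW n C M.relcat) := fun A => ∀ k, Cofibrant M (A.F.obj k)
  obtain ⟨R, α, hα, hR, hR'⟩ := exists_fibrant_chainDiagram M.op (E := (Fin (n + 1))ᵒᵖ)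
    (fun k => n - k.unop.1)
    (fun f => Nat.sub_le_sub_left (leOfHom f.unop) n) (fun {j k} _ h => by
      refine Opposite.unop_injective (Fin.ext ?_)
      have := j.unop.2
      have := k.unop.2
      omega)
    (LabelledChain.last (FunW n C M.relcat)ᵒᵖ ⋙ (FunW.forget n C M.relcat).op ⋙
      Functor.opHom _ _) (fun {x y} f k =>
      ((LabelledChain.last (FunW n C M.relcat)ᵒᵖ).map f).unop.2 k.unop)
  let R' : (LabelledChain (FunW n C M.relcat)ᵒᵖ)ᵒᵖ ⥤ FunW n C M.relcat :=
    { obj x := ⟨(R.obj x.unop).unop⟩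
      map f := ⟨NatTrans.unop (R.map f.unop), fun k => hR f.unop (.op k)⟩
      map_id x := Subtype.ext (congrArg NatTrans.unop (R.map_id x.unop))
      map_comp f g := Subtype.ext (congrArg NatTrans.unop (R.map_comp g.unop f.unop)) }
  exact isWeakHomotopyEquiv_of_chains Q.ι.op
    (ObjectProperty.lift Q R' (fun x k => M.cofibrant_of_fibrant_op (hR' x.unop (.op k)))).rightOp
    { app x := Quiver.Hom.op ⟨NatTrans.unop (α.app x), fun k => hα x (.op k)⟩
      naturality x y f := Quiver.Hom.unop_inj
        (Subtype.ext (congrArg NatTrans.unop (α.naturality f))) }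

end Opposite

section Op

/-- The reversal of a simplex of the standard simplex. -/
def simplexRev {n : SimplexCategory} {d : SimplexCategoryᵒᵖ}
    (x : (SSet.stdSimplex.{w}.obj n).obj d) : (SSet.stdSimplex.{w}.obj n).obj d :=
  SSet.opObjEquiv ((SSet.stdSimplex.opIso.{w} n).inv.app d x)

lemma simplexRev_simplexRev {n : ℕ} {d : SimplexCategoryᵒᵖ}
    (x : (Δ[n] : SSet.{w}).obj d) : simplexRev (simplexRev x) = x := by
  obtain ⟨⟨d⟩⟩ := d
  refine SSet.stdSimplex.ext _ _ fun i => ?_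
  refine (SSet.stdSimplex.opObjEquiv_opObjEquiv_symm_apply _ _).trans ?_
  refine (congrArg Fin.rev (SSet.stdSimplex.opObjEquiv_opObjEquiv_symm_apply _ _)).trans ?_
  rw [Fin.rev_rev, Fin.rev_rev]

lemma simplexRev_map {n : ℕ} {d d' : SimplexCategoryᵒᵖ} (f : d ⟶ d')
    (x : (Δ[n] : SSet.{w}).obj d) : simplexRev ((Δ[n] : SSet.{w}).map f x) =
      (Δ[n] : SSet.{w}).map (SimplexCategory.rev.map f.unop).op (simplexRev x) :=
  congrArg (fun k => k x) ((SSet.stdSimplex.opIso.{w} ⦋n⦌).inv.naturality f)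

lemma simplexRev_mem_horn {n : ℕ} (i : Fin (n + 1)) {d : SimplexCategoryᵒᵖ}
    (x : (Δ[n] : SSet.{w}).obj d) :
    simplexRev x ∈ (Λ[n, i] : (Δ[n] : SSet.{w}).Subcomplex).obj d ↔
      x ∈ (Λ[n, i.rev] : (Δ[n] : SSet.{w}).Subcomplex).obj d := by
  rw [← SSet.op_horn]
  exact Iff.rfl

open SSet.modelCategoryQuillen in
lemma kanComplex_op {K : SSet.{w}} (hK : SSet.KanComplex K) : SSet.KanComplex K.op := by
  refine (HomotopicalAlgebra.isFibrant_iff _).2 ⟨?_⟩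
  rw [fibrations_eq]
  intro _ _ _ hf
  simp only [J, MorphismProperty.iSup_iff] at hf
  obtain ⟨n, ⟨i⟩⟩ := hf
  refine ⟨fun {t _} _ => ?_⟩
  let σ₀ : (Λ[n + 1, i.rev] : SSet.{w}) ⟶ K :=
    { app d := ↾fun x => SSet.opObjEquiv (t.app d ⟨simplexRev x.1,
        (simplexRev_mem_horn i x.1).2 x.2⟩)
      naturality d d' f := by
        ext x
        refine (congrArg (t.app d')
          (a₂ := (Λ[n + 1, i] : SSet.{w}).map (SimplexCategory.rev.map f.unop).op
          ⟨simplexRev x.1, (simplexRev_mem_horn i x.1).2 x.2⟩)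
          (Subtype.ext (simplexRev_map f x.1))).trans ?_
        refine (congrArg (fun k => k ⟨simplexRev x.1, (simplexRev_mem_horn i x.1).2 x.2⟩)
          (t.naturality (SimplexCategory.rev.map f.unop).op)).trans ?_
        exact congrArg (fun g => K.map (Quiver.Hom.op g) _)
          (SimplexCategory.rev_map_rev_map f.unop) }
  obtain ⟨σ, hσ⟩ := SSet.KanComplex.hornFilling σ₀
  refine ⟨⟨{
    l := (SSet.stdSimplex.opIso.{w} ⦋n + 1⦌).inv ≫ SSet.opFunctor.map σ
    fac_left := ?_
    fac_right := by subsingleton }⟩⟩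
  refine hom_ext_apply fun d x => ?_
  refine (congrArg (fun k => k.app d ⟨simplexRev x.1, (simplexRev_mem_horn i.rev x.1).2
    (by rw [Fin.rev_rev]; exact x.2)⟩) hσ).symm.trans ?_
  exact congrArg (t.app d) (Subtype.ext (simplexRev_simplexRev x.1))

variable {X Y Z : SSet.{w}}

open MonoidalCategory in
lemma SHomotopy.op {f g : X ⟶ Y} (h : SHomotopy f g) :
    SHomotopy (SSet.opFunctor.map g) (SSet.opFunctor.map f) := by
  obtain ⟨H, rfl, rfl⟩ := h.exists_tensor
  refine SHomotopy.of_family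
    (fun m x t => H.app (.op m) ((show X.obj (.op m) from x),
      (SSet.stdSimplex.objEquiv.symm (SimplexCategory.rev.map t) : Δ[1].obj (.op m))))
    (fun l m θ x t => ?_) (fun m x => ?_) (fun m x => ?_)
  · let z : (X ⊗ Δ[1]).obj (.op m) := ((show X.obj (.op m) from x),
      (SSet.stdSimplex.objEquiv.symm (SimplexCategory.rev.map t) : Δ[1].obj (.op m)))
    refine (congrArg (fun k => k z) (H.naturality
      (X := .op m) (Y := .op l) (SimplexCategory.rev.map θ).op)).symm.trans ?_
    refine congrArg (H.app (.op l)) (Prod.ext ?_ ?_)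
    · rfl
    · exact congrArg SSet.stdSimplex.objEquiv.symm (SimplexCategory.rev.map_comp θ t).symm
  · rfl
  · rfl

lemma Htpy.op {f g : X ⟶ Y} (h : Htpy f g) :
    Htpy (SSet.opFunctor.map f) (SSet.opFunctor.map g) := by
  induction h with
  | rel f g h => exact h.op.htpy.symm
  | refl f => exact Relation.EqvGen.refl _
  | symm f g _ h => exact h.symm
  | trans f g k _ _ h h' => exact h.trans h'

instance : SSet.opFunctor.{w}.IsEquivalence := SSet.opEquivalence.isEquivalence_functor

lemma Htpy.of_op {f g : X ⟶ Y} (h : Htpy (SSet.opFunctor.map f) (SSet.opFunctor.map g)) :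
    Htpy f g := by
  have e (k : X ⟶ Y) : SSet.opFunctorCompOpFunctorIso.inv.app X ≫
      SSet.opFunctor.map (SSet.opFunctor.map k) ≫ SSet.opFunctorCompOpFunctorIso.hom.app Y = k :=
    NatIso.naturality_1 SSet.opFunctorCompOpFunctorIso k
  have := (h.op.postcomp (SSet.opFunctorCompOpFunctorIso.hom.app Y)).precomp
    (SSet.opFunctorCompOpFunctorIso.inv.app X)
  exact e f ▸ e g ▸ this

lemma IsWeakHomotopyEquiv.of_op {f : X ⟶ Y} (h : IsWeakHomotopyEquiv (SSet.opFunctor.map f)) :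
    IsWeakHomotopyEquiv f := by
  intro K hK
  obtain ⟨h₁, h₂⟩ := h K.op (kanComplex_op hK)
  refine ⟨fun g => ?_, fun a b hab => (h₂ _ _ ?_).of_op⟩
  · obtain ⟨a, ha⟩ := h₁ (SSet.opFunctor.map g)
    obtain ⟨a, rfl⟩ := SSet.opFunctor.map_surjective a
    rw [← Functor.map_comp] at ha
    exact ⟨a, ha.of_op⟩
  · rw [← Functor.map_comp, ← Functor.map_comp]
    exact hab.op

lemma IsWeakHomotopyEquiv.of_iso {X' Y' : SSet.{w}} {f : X ⟶ Y} {f' : X' ⟶ Y'}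
    (hf : IsWeakHomotopyEquiv f) (a : X' ≅ X) (b : Y' ≅ Y) (e : a.hom ≫ f = f' ≫ b.hom) :
    IsWeakHomotopyEquiv f' := by
  intro K hK
  obtain ⟨h₁, h₂⟩ := hf K hK
  refine ⟨fun g => ?_, fun h h' hh => ?_⟩
  · obtain ⟨k, hk⟩ := h₁ (a.inv ≫ g)
    refine ⟨b.hom ≫ k, ?_⟩
    have := hk.precomp a.hom
    rwa [a.hom_inv_id_assoc, reassoc_of% e] at this
  · have e' : f ≫ b.inv = a.inv ≫ f' := by
      rw [Iso.comp_inv_eq, Category.assoc, ← e, a.inv_hom_id_assoc]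
    have := (h₂ (b.inv ≫ h) (b.inv ≫ h') (by
      rw [reassoc_of% e', reassoc_of% e']
      exact hh.precomp a.inv)).precomp b.hom
    rwa [b.hom_inv_id_assoc, b.hom_inv_id_assoc] at this

/-- The reversal of a finite linear order. -/
def finRev (m : ℕ) : Fin (m + 1) ⥤ (Fin (m + 1))ᵒᵖ where
  obj i := .op i.rev
  map f := (homOfLE (Fin.rev_le_rev.2 (leOfHom f))).op

/-- Reversal of the simplices of a nerve. -/
def nerveOpIso (C : Type u) [Category.{v} C] : (nerve C).op ≅ nerve Cᵒᵖ :=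
  NatIso.ofComponents (fun d => Equiv.toIso
    { toFun := fun y : Fin (d.unop.len + 1) ⥤ C => finRev _ ⋙ y.op
      invFun := fun y : Fin (d.unop.len + 1) ⥤ Cᵒᵖ => finRev _ ⋙ y.leftOp
      left_inv := fun y : Fin (d.unop.len + 1) ⥤ C =>
        congrArg (fun F : Fin (d.unop.len + 1) ⥤ Fin (d.unop.len + 1) => F ⋙ y)
          (a₁ := finRev _ ⋙ (finRev _).leftOp) (a₂ := 𝟭 _)
          (CategoryTheory.Functor.ext Fin.rev_rev (fun _ _ _ => Subsingleton.elim _ _))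
      right_inv := fun y : Fin (d.unop.len + 1) ⥤ Cᵒᵖ =>
        congrArg (fun F : Fin (d.unop.len + 1) ⥤ Fin (d.unop.len + 1) => F ⋙ y)
          (a₁ := finRev _ ⋙ (finRev _).leftOp) (a₂ := 𝟭 _)
          (CategoryTheory.Functor.ext Fin.rev_rev (fun _ _ _ => Subsingleton.elim _ _)) })
    (fun {d d'} f => by
      refine ConcreteCategory.hom_ext _ _ fun (y : Fin (d.unop.len + 1) ⥤ C) => ?_
      refine congrArg (fun F : Fin (d'.unop.len + 1) ⥤ (Fin (d.unop.len + 1))ᵒᵖ => F ⋙ y.op)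
        (a₁ := finRev _ ⋙ (SimplexCategory.rev.map f.unop).toOrderHom.monotone.functor.op)
        (a₂ := f.unop.toOrderHom.monotone.functor ⋙ finRev _)
        (CategoryTheory.Functor.ext (fun i => ?_) (fun _ _ _ => Subsingleton.elim _ _))
      refine congrArg Opposite.op ((SimplexCategory.rev_map_apply _ _).trans ?_)
      exact congrArg (fun j => (f.unop.toOrderHom j).rev) (Fin.rev_rev i))

lemma IsWeakHomotopyEquiv.of_nerveMap_op {C D : Type u} [Category.{v} C] [Category.{v} D]
    {F : C ⥤ D} (h : IsWeakHomotopyEquiv (nerveMap F.op)) : IsWeakHomotopyEquiv (nerveMap F) :=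
  (h.of_iso (f' := SSet.opFunctor.map (nerveMap F)) (nerveOpIso C) (nerveOpIso D)
    (hom_ext_apply fun _ _ => rfl)).of_op

end Op

/-- for model categories `C`, `D` and every `n ≥ 0`, the inclusion
`Fun([n],D^f)^{W^f} ↪ Fun([n],D)^{W}` induces a weak homotopy equivalence of nerves,
and dually the inclusion `Fun([n],C^c)^{W^c} ↪ Fun([n],C)^{W}` induces a weak homotopy
equivalence of nerves. -/
theorem statement0 {C : Type u} {D : Type u} [Category.{v} C] [Category.{v} D]
    [HasFiniteLimits C] [HasFiniteColimits C] [HasFiniteLimits D] [HasFiniteColimits D]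
    (MC : ModelStructure C) (MD : ModelStructure D) (n : ℕ) :
    IsWeakHomotopyEquiv (nerveMap (ObjectProperty.ι
      (fun A : FunW n D MD.relcat => ∀ k, Fibrant MD (A.F.obj k)))) ∧
    IsWeakHomotopyEquiv (nerveMap (ObjectProperty.ι
      (fun A : FunW n C MC.relcat => ∀ k, Cofibrant MC (A.F.obj k)))) :=
  ⟨isWeakHomotopyEquiv_fibrant MD n, (isWeakHomotopyEquiv_op_cofibrant MC n).of_nerveMap_op⟩

end Paper
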